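/- arXiv:1305.7240 — 2 statements merged into one kernel-verified Lean document; each statement's English description precedes it below -/
import Mathlib

section
/- Let d = 2, let p₀ ≥ 1 and 1 ≤ p ≤ p₀ be integers, let k ≥ 1 and 1 ≤ j ≤ k, and let α satisfy 1 − 1/(2(2p₀ − 1)) < α < 1. Then there exists a constant C_α > 0, depending only on α and p₀ (and independent of k and j), such that the following holds. For every Schwartz function γ₀ on ℝ^{2(k+p)} × ℝ^{2(k+p)}, let γ(t) be the free evolution of γ₀, defined on the Fourier side by γ̂(t, ξ; ξ') = e^{−it(|ξ|² − |ξ'|²)} γ̂₀(ξ; ξ') for ξ, ξ' ∈ ℝ^{2(k+p)}. Then ‖S^{(k,α)} B_{j;k+1,…,k+p} γ‖_{L²(ℝ_t × ℝ^{2k} × ℝ^{2k})} ≤ C_α ‖S^{(k+p,α)} γ₀‖_{L²(ℝ^{2(k+p)} × ℝ^{2(k+p)})}, where the left-hand side is the L² norm in the time variable t ∈ ℝ and the spatial variables jointly. -/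
open MeasureTheory
open scoped FourierTransform ENNReal
/-- Interpret a plain function on the index set as a point of the corresponding
Euclidean space (they are definitionally equal). -/
noncomputable def toEuc (ι : Type*) [Fintype ι] (g : ι → ℝ) : EuclideanSpace ℝ ι := WithLp.toLp 2 g

/-- The pair space `ℝ^{dn} × ℝ^{dn}`, realized as one Euclidean space: the `Sum.inl`
indices are the unprimed variables and the `Sum.inr` indices the primed variables. -/
abbrev PairSpace (d n : ℕ) :=
  EuclideanSpace ℝ ((Fin n × Fin d) ⊕ (Fin n × Fin d))

/-- The contraction operator `B_{j;k+1,…,k+p}`. -/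
noncomputable def contractB (d k p : ℕ) (j : Fin k)
    (γ : PairSpace d (k + p) → ℂ) (z : PairSpace d k) : ℂ :=
  let x : Fin k → Fin d → ℝ := fun l i => z (Sum.inl (l, i))
  let x' : Fin k → Fin d → ℝ := fun l i => z (Sum.inr (l, i))
  let ext : (Fin k → Fin d → ℝ) → (Fin d → ℝ) → (Fin (k + p) × Fin d) → ℝ :=
    fun w y q => if h : (q.1 : ℕ) < k then w ⟨q.1, h⟩ q.2 else y q.2
  γ (toEuc _ (Sum.elim (ext x (x j)) (ext x' (x j)))) -
    γ (toEuc _ (Sum.elim (ext x (x' j)) (ext x' (x' j))))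

/-- The symbol of the Fourier multiplier `S^{(n,α)}`:
`∏_{l=1}^n ⟨ξ_l⟩^α ⟨ξ'_l⟩^α` with `⟨ξ⟩ = (1+|ξ|²)^{1/2}`. -/
noncomputable def weightS (d n : ℕ) (α : ℝ) (ζ : PairSpace d n) : ℝ :=
  ∏ l : Fin n,
    ((1 + ∑ i : Fin d, (ζ (Sum.inl (l, i))) ^ 2) ^ (α / 2) *
      (1 + ∑ i : Fin d, (ζ (Sum.inr (l, i))) ^ 2) ^ (α / 2))

/-- `|ξ|²`, the squared Euclidean norm of the unprimed Fourier block. -/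
noncomputable def normSqUnprimed (d n : ℕ) (ζ : PairSpace d n) : ℝ :=
  ∑ q : Fin n × Fin d, (ζ (Sum.inl q)) ^ 2

/-- `|ξ'|²`, the squared Euclidean norm of the primed Fourier block. -/
noncomputable def normSqPrimed (d n : ℕ) (ζ : PairSpace d n) : ℝ :=
  ∑ q : Fin n × Fin d, (ζ (Sum.inr q)) ^ 2

/-- The free evolution of a kernel `γ₀`, defined on the Fourier side by
`γ̂(t, ξ; ξ') = e^{−it(|ξ|² − |ξ'|²)} γ̂₀(ξ; ξ')`. -/
noncomputable def freeEvolution (d n : ℕ) (γ₀ : PairSpace d n → ℂ) (t : ℝ)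
    (z : PairSpace d n) : ℂ :=
  𝓕⁻ (fun ζ : PairSpace d n =>
    Complex.exp (-Complex.I * t * ((normSqUnprimed d n ζ : ℂ) - (normSqPrimed d n ζ : ℂ))) *
      𝓕 γ₀ ζ) z

lemma plancherel_aux (f : ℝ → ℂ) (hf : Integrable f) (h2 : MemLp f 2) :
    eLpNorm (𝓕 f) 2 volume = eLpNorm f 2 volume := by
  set F : Lp ℂ 2 (volume : Measure ℝ) := h2.toLp f with hF
  have hcont : Continuous (𝓕 f) := VectorFourier.fourierIntegral_continuous
    Real.continuous_fourierChar (by fun_prop) hf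
  have key : ∀ᵐ x : ℝ, (𝓕 F : Lp ℂ 2 (volume : Measure ℝ)) x = 𝓕 f x := by
    apply ae_eq_of_integral_contDiff_smul_eq
    · exact (Lp.memLp (𝓕 F)).locallyIntegrable (by norm_num)
    · exact hcont.locallyIntegrable
    intro g hg hgs
    have hg' : ContDiff ℝ (⊤ : ℕ∞) (fun x => (g x : ℂ)) := by
      exact Complex.ofRealCLM.contDiff.comp hg
    have hgs' : HasCompactSupport (fun x => (g x : ℂ)) := by
      exact hgs.comp_left (g := fun x : ℝ => (x : ℂ)) (by simp)
    set G := hgs'.toSchwartzMap hg'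
    have h1 := DFunLike.congr_fun (Lp.fourier_toTemperedDistribution_eq F) G
    rw [TemperedDistribution.fourier_apply, Lp.toTemperedDistribution_apply,
      Lp.toTemperedDistribution_apply] at h1
    have h3 : ∫ x, (𝓕 G) x • F x = ∫ x, (𝓕 G) x • f x := by
      apply integral_congr_ae
      filter_upwards [h2.coeFn_toLp] with x hx
      rw [hx]
    have h4 : ∫ x, (𝓕 G) x • f x = ∫ x, G x • 𝓕 f x := by
      have := VectorFourier.integral_fourierIntegral_smul_eq_flip (L := innerₗ ℝ) (μ := volume)
        (ν := volume) Real.continuous_fourierChar (by fun_prop) G.integrable hf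
      simpa using! this
    have := h1.symm.trans (h3.trans h4)
    simpa [G] using! this
  rw [← eLpNorm_congr_ae key, ← eLpNorm_congr_ae h2.coeFn_toLp]
  have := Lp.norm_fourier_eq F
  rw [Lp.norm_def, Lp.norm_def, ENNReal.toReal_eq_toReal_iff' (Lp.eLpNorm_ne_top _) (Lp.eLpNorm_ne_top _)] at this
  exact this

lemma bessel_scaled (c l : ℝ) (f : ℝ → ℂ) (hf : Integrable f) :
    ∫⁻ t : ℝ, ‖∫ s : ℝ, Complex.exp (-Complex.I * t * ((c + l * s : ℝ) : ℂ)) * f s‖ₑ ^ 2 ≤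
      ENNReal.ofReal (2 * Real.pi) / ENNReal.ofReal |l| * ∫⁻ s, ‖f s‖ₑ ^ 2 := by
  have hpi := Real.pi_pos
  by_cases h0 : ∫⁻ s, ‖f s‖ₑ ^ 2 = 0
  · have : f =ᵐ[volume] 0 := by
      rw [lintegral_eq_zero_iff' (by have := hf.1; fun_prop)] at h0
      filter_upwards [h0] with x hx
      simpa using hx
    have h : ∀ t : ℝ, ∫ s : ℝ, Complex.exp (-Complex.I * t * ((c + l * s : ℝ) : ℂ)) * f s = 0 := by
      intro t
      rw [integral_eq_zero_of_ae]
      filter_upwards [this] with s hs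
      simp [hs]
    simp only [h]; simp
  by_cases hl : l = 0
  · have : ENNReal.ofReal (2 * Real.pi) / ENNReal.ofReal |l| = ⊤ := by
      rw [hl]; simp [ENNReal.div_zero, hpi]
    rw [this, ENNReal.top_mul h0]; exact le_top
  by_cases h2 : ∫⁻ s, ‖f s‖ₑ ^ 2 = ⊤
  · rw [h2, ENNReal.mul_top]; exact le_top
    simp [hpi]
  have hm : MemLp f 2 := by
    refine ⟨hf.1, ?_⟩
    rw [eLpNorm_lt_top_iff_lintegral_rpow_enorm_lt_top (by norm_num) (by norm_num)]
    simpa using lt_top_iff_ne_top.2 h2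
  have hP := plancherel_aux f hf hm
  have hP2 : ∫⁻ t, ‖𝓕 f t‖ₑ ^ 2 = ∫⁻ s, ‖f s‖ₑ ^ 2 := by
    have := congrArg (fun x => x ^ (2 : ℝ)) hP
    simp only [eLpNorm_eq_lintegral_rpow_enorm_toReal (two_ne_zero) (ENNReal.ofNat_ne_top)] at this
    simp only [← ENNReal.rpow_mul] at this
    simpa using this
  have hE : ∀ t : ℝ, ‖∫ s : ℝ, Complex.exp (-Complex.I * t * ((c + l * s : ℝ) : ℂ)) * f s‖ₑ
      = ‖𝓕 f ((l / (2 * Real.pi)) * t)‖ₑ := by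
    intro t
    have : ∫ s : ℝ, Complex.exp (-Complex.I * t * ((c + l * s : ℝ) : ℂ)) * f s
        = Complex.exp (((- t * c : ℝ) : ℂ) * Complex.I) * 𝓕 f ((l / (2 * Real.pi)) * t) := by
      rw [Real.fourier_eq', ← integral_const_mul]
      congr 1; ext s
      rw [smul_eq_mul, ← mul_assoc, ← Complex.exp_add]
      congr 2
      have : (Real.pi : ℂ) ≠ 0 := by exact_mod_cast hpi.ne'
      simp
      field_simp
      ring
    rw [this, enorm_mul, ← ofReal_norm, Complex.norm_exp_ofReal_mul_I]; simp
  simp only [hE]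
  have hmeas : Measurable (fun t => ‖𝓕 f t‖ₑ ^ 2) := by
    have hcont : Continuous (𝓕 f) := VectorFourier.fourierIntegral_continuous
      Real.continuous_fourierChar (by fun_prop) hf
    fun_prop
  have hne : l / (2 * Real.pi) ≠ 0 := by positivity
  have hmap := Real.map_volume_mul_left hne
  have : ∫⁻ t, ‖𝓕 f ((l / (2 * Real.pi)) * t)‖ₑ ^ 2 = ENNReal.ofReal |(l / (2 * Real.pi))⁻¹| * ∫⁻ t, ‖𝓕 f t‖ₑ ^ 2 := by
    rw [← smul_eq_mul (ENNReal.ofReal _), ← lintegral_smul_measure, ← hmap, lintegral_map hmeas (by fun_prop)]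
  rw [this, hP2]
  gcongr
  rw [inv_div, abs_div, abs_of_pos (by positivity : 0 < 2 * Real.pi), ENNReal.ofReal_div_of_pos (by positivity)]
lemma weighted_cs {M : Type*} [MeasurableSpace M] (μ : Measure M) (W a : M → ℝ≥0∞)
    (hW : Measurable W) (ha : AEMeasurable a μ) (hW0 : ∀ m, W m ≠ 0) (hWt : ∫⁻ m, W m ∂μ ≠ ⊤) :
    (∫⁻ m, a m ∂μ) ^ 2 ≤ (∫⁻ m, W m ∂μ) * ∫⁻ m, (W m)⁻¹ * a m ^ 2 ∂μ := by
  have h1 : ∫⁻ m, a m ∂μ = ∫⁻ m, (W m ^ (1/2 : ℝ)) * ((W m)⁻¹ ^ (1/2 : ℝ) * a m) ∂μ := by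
    apply lintegral_congr_ae
    filter_upwards [ae_lt_top' hW.aemeasurable hWt] with m hm
    rw [← mul_assoc, ← ENNReal.mul_rpow_of_nonneg _ _ (by norm_num),
      ENNReal.mul_inv_cancel (hW0 m) hm.ne]
    simp
  have h2 := ENNReal.lintegral_mul_le_Lp_mul_Lq μ Real.HolderConjugate.two_two
    (f := fun m => W m ^ (1/2 : ℝ)) (g := fun m => (W m)⁻¹ ^ (1/2 : ℝ) * a m)
    (by fun_prop) (by fun_prop)
  rw [h1]
  calc _ ≤ _ := pow_le_pow_left' h2 2
    _ = _ := by
      rw [mul_pow, ← ENNReal.rpow_two, ← ENNReal.rpow_two, ← ENNReal.rpow_mul, ← ENNReal.rpow_mul]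
      norm_num
      congr 1
      · congr 1; ext m; rw [← ENNReal.rpow_two, ← ENNReal.rpow_mul]; simp
      · congr 1; ext m
        rw [mul_pow, ← ENNReal.rpow_two, ← ENNReal.rpow_mul]; simp

set_option maxHeartbeats 1000000 in
lemma core1 {M : Type*} [MeasurableSpace M] (μ : Measure M) [SFinite μ] (c l : M → ℝ)
    (hc : Measurable c) (hl : Measurable l) (g : M × ℝ → ℂ) (hgm : Measurable g)
    (hg : Integrable g (μ.prod volume))
    (W : M → ℝ≥0∞) (hW : Measurable W) (hW0 : ∀ m, W m ≠ 0) (hWt : ∫⁻ m, W m ∂μ ≠ ⊤) :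
    ∫⁻ t : ℝ, ‖∫ x : M × ℝ, Complex.exp (-Complex.I * t * ((c x.1 + l x.1 * x.2 : ℝ) : ℂ)) * g x
        ∂(μ.prod volume)‖ₑ ^ 2 ≤
      (∫⁻ m, W m ∂μ) * ∫⁻ x : M × ℝ, (W x.1)⁻¹ *
        (ENNReal.ofReal (2 * Real.pi) / ENNReal.ofReal |l x.1|) * ‖g x‖ₑ ^ 2 ∂(μ.prod volume) := by
  have hunit : ∀ (t y : ℝ), ‖Complex.exp (-Complex.I * t * (y : ℂ))‖ = 1 := by
    intro t y
    rw [show -Complex.I * t * (y : ℂ) = ((-t * y : ℝ) : ℂ) * Complex.I by push_cast; ring]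
    exact Complex.norm_exp_ofReal_mul_I _
  set E : ℝ → M × ℝ → ℂ := fun t x =>
    Complex.exp (-Complex.I * t * ((c x.1 + l x.1 * x.2 : ℝ) : ℂ)) * g x with hE
  have hEm : Measurable (fun y : (ℝ × M) × ℝ => E y.1.1 (y.1.2, y.2)) := by
    simp only [hE]; fun_prop
  have hEi : ∀ t, Integrable (E t) (μ.prod volume) := by
    intro t
    refine hg.mono (by simp only [hE]; fun_prop) (ae_of_all _ fun x => ?_)
    simp only [hE, norm_mul, hunit, one_mul, le_refl]
  set h : ℝ × M → ℂ := fun y => ∫ s, E y.1 (y.2, s) with hh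
  have hhm : Measurable h := (hEm.stronglyMeasurable.integral_prod_right').measurable
  have step : ∀ t : ℝ, ‖∫ x : M × ℝ, E t x ∂(μ.prod volume)‖ₑ ^ 2 ≤
      (∫⁻ m, W m ∂μ) * ∫⁻ m, (W m)⁻¹ * ‖h (t, m)‖ₑ ^ 2 ∂μ := by
    intro t
    rw [integral_prod _ (hEi t)]
    refine le_trans (pow_le_pow_left' (enorm_integral_le_lintegral_enorm _) 2) ?_
    exact weighted_cs μ W (fun m => ‖h (t, m)‖ₑ) hW (by fun_prop) hW0 hWt
  calc _ ≤ ∫⁻ t : ℝ, (∫⁻ m, W m ∂μ) * ∫⁻ m, (W m)⁻¹ * ‖h (t, m)‖ₑ ^ 2 ∂μ := lintegral_mono step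
    _ = (∫⁻ m, W m ∂μ) * ∫⁻ t : ℝ, ∫⁻ m, (W m)⁻¹ * ‖h (t, m)‖ₑ ^ 2 ∂μ := by
      rw [lintegral_const_mul']; exact hWt
    _ = (∫⁻ m, W m ∂μ) * ∫⁻ m, (∫⁻ t : ℝ, (W m)⁻¹ * ‖h (t, m)‖ₑ ^ 2) ∂μ := by
      rw [lintegral_lintegral_swap]
      fun_prop
    _ ≤ (∫⁻ m, W m ∂μ) * ∫⁻ m, (∫⁻ s : ℝ, (W m)⁻¹ *
        (ENNReal.ofReal (2 * Real.pi) / ENNReal.ofReal |l m|) * ‖g (m, s)‖ₑ ^ 2) ∂μ := by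
      gcongr 1
      apply lintegral_mono_ae
      filter_upwards [hg.prod_right_ae] with m hm
      rw [lintegral_const_mul _ (by fun_prop), lintegral_const_mul _ (by fun_prop), mul_assoc]
      gcongr
      have := bessel_scaled (c m) (l m) (fun s => g (m, s)) hm
      exact this
    _ = _ := by
      rw [lintegral_prod _ (by fun_prop)]

lemma loc_int (β : ℝ) (h1 : β < 1) :
    Integrable (fun y : ℝ => Set.indicator (Set.Ioc (-1) 1) (fun y => |y| ^ (-β)) y) := by
  rw [integrable_indicator_iff measurableSet_Ioc, ← intervalIntegrable_iff_integrableOn_Ioc_of_le (by norm_num)]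
  have hp : IntervalIntegrable (fun y : ℝ => |y| ^ (-β)) volume 0 1 := by
    refine (intervalIntegral.intervalIntegrable_rpow' (r := -β) (by linarith)).congr ?_
    intro x hx
    rw [Set.uIoc_of_le (by norm_num)] at hx
    simp only
    rw [abs_of_pos hx.1]
  have hn : IntervalIntegrable (fun y : ℝ => |y| ^ (-β)) volume (-1) 0 := by
    rw [IntervalIntegrable.iff_comp_neg]
    simpa using hp.symm
  exact hn.trans hp

lemma tail_int (γ : ℝ) (h1 : 1 < γ) : Integrable (fun y : ℝ => (1 + y ^ 2) ^ (-γ / 2)) := by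
  have := integrable_rpow_neg_one_add_norm_sq (E := ℝ) (μ := volume) (r := γ) (by simpa using h1)
  simpa using this

lemma half_bd (β y : ℝ) (hβ : 0 < β) (hy : 1 / 2 ≤ |y|) :
    |y| ^ (-β) ≤ 5 ^ (β / 2) * (1 + y ^ 2) ^ (-β / 2) := by
  have h0 : 0 < |y| := by linarith
  have hy2 : y ^ 2 = |y| ^ 2 := (sq_abs y).symm
  have h1 : |y| ^ (-β) = (y ^ 2) ^ (-β / 2) := by
    rw [hy2, ← Real.rpow_natCast, ← Real.rpow_mul h0.le]; congr 1; push_cast; ring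
  have h2 : (5 : ℝ) ^ (β / 2) * (1 + y ^ 2) ^ (-β / 2) = ((1 + y ^ 2) / 5) ^ (-β / 2) := by
    rw [Real.div_rpow (by positivity) (by norm_num), neg_div, Real.rpow_neg (x := 5) (by norm_num)]
    field_simp
  rw [h1, h2]
  apply Real.rpow_le_rpow_of_nonpos (by positivity) (by nlinarith) (by linarith)

lemma pw1 (α β y v : ℝ) (hα : 0 < α) (hβ : 0 < β) :
    |y| ^ (-β) * (1 + v ^ 2) ^ (-α / 2) ≤
      Set.indicator (Set.Ioc (-1) 1) (fun y => |y| ^ (-β)) y +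
      5 ^ (β / 2) * ((1 + y ^ 2) ^ (-(α + β) / 2) + (1 + v ^ 2) ^ (-(α + β) / 2)) := by
  have hv1 : (1 + v ^ 2) ^ (-α / 2) ≤ 1 := by
    apply Real.rpow_le_one_of_one_le_of_nonpos (by nlinarith [sq_nonneg v]) (by linarith)
  have hI : 0 ≤ Set.indicator (Set.Ioc (-1) 1) (fun y : ℝ => |y| ^ (-β)) y := by
    apply Set.indicator_nonneg; intro x _; positivity
  by_cases hy : y ∈ Set.Ioc (-1 : ℝ) 1
  · rw [Set.indicator_of_mem hy]
    have : 0 ≤ |y| ^ (-β) := by positivity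
    have h3 : 0 ≤ (5:ℝ) ^ (β / 2) * ((1 + y ^ 2) ^ (-(α + β) / 2) + (1 + v ^ 2) ^ (-(α + β) / 2)) := by
      positivity
    nlinarith
  · have hy1 : 1 / 2 ≤ |y| := by
      by_contra hc
      push Not at hc
      rw [abs_lt] at hc
      exact hy ⟨by linarith, by linarith⟩
    have h1 := half_bd β y hβ hy1
    have h2 : (1 + y ^ 2) ^ (-β / 2) * (1 + v ^ 2) ^ (-α / 2) ≤
      (1 + y ^ 2) ^ (-(α + β) / 2) + (1 + v ^ 2) ^ (-(α + β) / 2) := by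
      have pa : 0 < 1 + y ^ 2 := by positivity
      have pb : 0 < 1 + v ^ 2 := by positivity
      rw [show -(α + β) / 2 = -β / 2 + -α / 2 by ring, Real.rpow_add pa, Real.rpow_add pb]
      rcases le_total (1 + y ^ 2) (1 + v ^ 2) with h | h
      · have : (1 + v ^ 2) ^ (-α / 2) ≤ (1 + y ^ 2) ^ (-α / 2) :=
          Real.rpow_le_rpow_of_nonpos pa h (by linarith)
        have := mul_le_mul_of_nonneg_left this (by positivity : 0 ≤ (1 + y ^ 2) ^ (-β / 2))
        have : 0 ≤ (1 + v ^ 2) ^ (-β / 2) * (1 + v ^ 2) ^ (-α / 2) := by positivity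
        linarith
      · have : (1 + y ^ 2) ^ (-β / 2) ≤ (1 + v ^ 2) ^ (-β / 2) :=
          Real.rpow_le_rpow_of_nonpos pb h (by linarith)
        have := mul_le_mul_of_nonneg_right this (by positivity : 0 ≤ (1 + v ^ 2) ^ (-α / 2))
        have : 0 ≤ (1 + y ^ 2) ^ (-β / 2) * (1 + y ^ 2) ^ (-α / 2) := by positivity
        linarith
    calc _ ≤ 5 ^ (β / 2) * (1 + y ^ 2) ^ (-β / 2) * (1 + v ^ 2) ^ (-α / 2) := by gcongr
      _ ≤ 5 ^ (β / 2) * ((1 + y ^ 2) ^ (-(α + β) / 2) + (1 + v ^ 2) ^ (-(α + β) / 2)) := by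
        rw [mul_assoc]; gcongr
      _ ≤ _ := by linarith

lemma claimB1 (α β : ℝ) (hα : 0 < α) (hβ : 0 < β) (hβ1 : β < 1) (h : 1 < α + β) :
    ∃ C : ℝ≥0∞, C ≠ ⊤ ∧ ∀ x : ℝ,
      ∫⁻ v : ℝ, ENNReal.ofReal |x - v| ^ (-β) * ENNReal.ofReal ((1 + v ^ 2) ^ (-α / 2)) ≤ C := by
  have iL := loc_int β hβ1
  have iT := tail_int (α + β) h
  set L := fun y : ℝ => Set.indicator (Set.Ioc (-1) 1) (fun y => |y| ^ (-β)) y with hL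
  set T := fun y : ℝ => (1 + y ^ 2) ^ (-(α + β) / 2) with hT
  have hL0 : ∀ y, 0 ≤ L y := fun y => by
    apply Set.indicator_nonneg; intro x _; positivity
  have hT0 : ∀ y, 0 ≤ T y := fun y => by simp only [hT]; positivity
  refine ⟨(∫⁻ y, ENNReal.ofReal (L y)) + ENNReal.ofReal (5 ^ (β / 2)) * (∫⁻ y, ENNReal.ofReal (T y))
    + ENNReal.ofReal (5 ^ (β / 2)) * ∫⁻ y, ENNReal.ofReal (T y), ?_, ?_⟩
  · have h1 := (iL.lintegral_lt_top).ne
    have h2 := (iT.lintegral_lt_top).ne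
    exact ENNReal.add_ne_top.2 ⟨ENNReal.add_ne_top.2 ⟨h1, ENNReal.mul_ne_top ENNReal.ofReal_ne_top h2⟩,
      ENNReal.mul_ne_top ENNReal.ofReal_ne_top h2⟩
  intro x
  have mT : Measurable T := by simp only [hT]; fun_prop
  have mL : Measurable L := by
    simp only [hL]
    exact Measurable.indicator (by fun_prop) measurableSet_Ioc
  rw [← lintegral_sub_left_eq_self (fun y => ENNReal.ofReal (L y)) x]
  nth_rewrite 1 [← lintegral_sub_left_eq_self (fun y => ENNReal.ofReal (T y)) x]
  rw [← lintegral_const_mul _ (by fun_prop), ← lintegral_const_mul _ (by fun_prop),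
    ← lintegral_add_left (by fun_prop), ← lintegral_add_left (by fun_prop)]
  apply lintegral_mono_ae
  have : ∀ᵐ v : ℝ, v ≠ x := by simp [ae_iff, measure_singleton]
  filter_upwards [this] with v hv
  have hpos : 0 < |x - v| := abs_pos.2 (sub_ne_zero.2 hv.symm)
  rw [ENNReal.ofReal_rpow_of_pos hpos, ← ENNReal.ofReal_mul (by positivity),
    ← ENNReal.ofReal_mul (by positivity), ← ENNReal.ofReal_mul (by positivity),
    ← ENNReal.ofReal_add (hL0 _) (mul_nonneg (by positivity) (hT0 _)),
    ← ENNReal.ofReal_add (add_nonneg (hL0 _) (mul_nonneg (by positivity) (hT0 _))) (mul_nonneg (by positivity) (hT0 _))]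
  apply ENNReal.ofReal_le_ofReal
  have := pw1 α β (x - v) v hα hβ
  simp only [hL, hT]
  linarith

lemma half_bd' (β y : ℝ) (hβ : 0 < β) (hy : 1 / 2 ≤ |y|) :
    ENNReal.ofReal |y| ^ (-β) ≤ ENNReal.ofReal (5 ^ (β / 2)) * ENNReal.ofReal ((1 + y ^ 2) ^ (-β / 2)) := by
  rw [ENNReal.ofReal_rpow_of_pos (by linarith), ← ENNReal.ofReal_mul (by positivity)]
  exact ENNReal.ofReal_le_ofReal (half_bd β y hβ hy)

lemma claimA1 (α β : ℝ) (hα : 0 < α) (hα1 : α < 1) (hβ : 0 < β) (hβ1 : β < 1) (h : 1 < α + β) :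
    ∃ C : ℝ≥0∞, C ≠ ⊤ ∧ ∀ x : ℝ,
      ∫⁻ v : ℝ, ENNReal.ofReal |x - v| ^ (-β) * ENNReal.ofReal ((1 + v ^ 2) ^ (-α / 2)) ≤
        C * ENNReal.ofReal |x| ^ (-(β + α - 1)) := by
  obtain ⟨C₁, hC₁, h₁⟩ := claimB1 α β hα hβ hβ1 h
  obtain ⟨C₂, hC₂, h₂⟩ := claimB1 β α hβ hα hα1 (by linarith)
  set C := ENNReal.ofReal (5 ^ (α / 2)) * C₁ + ENNReal.ofReal (5 ^ (β / 2)) * C₂ + 1 with hC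
  have hC0 : C ≠ 0 := by simp [hC]
  refine ⟨C, ?_, ?_⟩
  · simp [hC, ENNReal.mul_eq_top, hC₁, hC₂]
  have one : ∫⁻ v : ℝ, ENNReal.ofReal |1 - v| ^ (-β) * ENNReal.ofReal |v| ^ (-α) ≤ C := by
    have h2 := h₂ 1
    rw [← lintegral_sub_left_eq_self _ (1 : ℝ)] at h2
    have h1 := h₁ 1
    calc _ ≤ ∫⁻ v : ℝ, (ENNReal.ofReal (5 ^ (α / 2)) * (ENNReal.ofReal |1 - v| ^ (-β) * ENNReal.ofReal ((1 + v ^ 2) ^ (-α / 2)))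
          + ENNReal.ofReal (5 ^ (β / 2)) * (ENNReal.ofReal |1 - (1 - v)| ^ (-α) * ENNReal.ofReal ((1 + (1 - v) ^ 2) ^ (-β / 2)))) := by
          apply lintegral_mono
          intro v
          simp only
          rcases le_total (1/2) |v| with hv | hv
          · refine le_trans ?_ le_self_add
            have := half_bd' α v hα hv
            calc _ ≤ ENNReal.ofReal |1 - v| ^ (-β) * (ENNReal.ofReal (5 ^ (α / 2)) * ENNReal.ofReal ((1 + v ^ 2) ^ (-α / 2))) := by gcongr
              _ = _ := by ring
          · refine le_trans ?_ le_add_self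
            have hv' : 1 / 2 ≤ |1 - v| := by
              rw [abs_le] at hv
              exact le_trans (by linarith) (le_abs_self _)
            have := half_bd' β (1 - v) hβ hv'
            rw [sub_sub_cancel]
            calc _ ≤ (ENNReal.ofReal (5 ^ (β / 2)) * ENNReal.ofReal ((1 + (1 - v) ^ 2) ^ (-β / 2))) * ENNReal.ofReal |v| ^ (-α) := by gcongr
              _ = _ := by ring
      _ = _ := by
          rw [lintegral_add_left (by fun_prop), lintegral_const_mul _ (by fun_prop), lintegral_const_mul _ (by fun_prop)]
      _ ≤ C := by
          rw [hC]
          refine le_trans ?_ le_self_add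
          gcongr
  intro x
  by_cases hx : x = 0
  · subst hx
    simp only [abs_zero, ENNReal.ofReal_zero]
    rw [ENNReal.zero_rpow_of_neg (by linarith), ENNReal.mul_top hC0]; exact le_top
  have hxp : 0 < |x| := abs_pos.2 hx
  have hx0 : ENNReal.ofReal |x| ≠ 0 := by simpa using hx
  calc _ ≤ ∫⁻ v : ℝ, ENNReal.ofReal |x - v| ^ (-β) * ENNReal.ofReal |v| ^ (-α) := by
        apply lintegral_mono_ae
        have : ∀ᵐ v : ℝ, v ≠ 0 := by simp [ae_iff, measure_singleton]
        filter_upwards [this] with v hv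
        gcongr
        rw [ENNReal.ofReal_rpow_of_pos (abs_pos.2 hv)]
        apply ENNReal.ofReal_le_ofReal
        have h1 : |v| ^ (-α) = (v ^ 2) ^ (-α / 2) := by
          rw [← sq_abs v, ← Real.rpow_natCast, ← Real.rpow_mul (abs_nonneg v)]; congr 1; push_cast; ring
        rw [h1]
        exact Real.rpow_le_rpow_of_nonpos (by positivity) (by linarith) (by linarith)
    _ = ENNReal.ofReal |x| * ∫⁻ w : ℝ, ENNReal.ofReal |x - x * w| ^ (-β) * ENNReal.ofReal |x * w| ^ (-α) := by
        nth_rewrite 1 [← Real.smul_map_volume_mul_left hx]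
        rw [lintegral_smul_measure, lintegral_map (by fun_prop) (by fun_prop), smul_eq_mul]
    _ = ENNReal.ofReal |x| * ∫⁻ w : ℝ, ENNReal.ofReal |x| ^ (-β - α) * (ENNReal.ofReal |1 - w| ^ (-β) * ENNReal.ofReal |w| ^ (-α)) := by
        congr 2; ext w
        rw [show x - x * w = x * (1 - w) by ring, abs_mul, abs_mul, ENNReal.ofReal_mul hxp.le, ENNReal.ofReal_mul hxp.le,
          ENNReal.mul_rpow_of_ne_top (by simp) (by simp), ENNReal.mul_rpow_of_ne_top (by simp) (by simp), sub_eq_add_neg (-β),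
          ENNReal.rpow_add _ _ hx0 (by simp)]
        ring
    _ = ENNReal.ofReal |x| ^ (-(β + α - 1)) * ∫⁻ w : ℝ, (ENNReal.ofReal |1 - w| ^ (-β) * ENNReal.ofReal |w| ^ (-α)) := by
        rw [lintegral_const_mul _ (by fun_prop), ← mul_assoc]
        congr 1
        nth_rewrite 1 [← ENNReal.rpow_one (ENNReal.ofReal |x|)]
        rw [← ENNReal.rpow_add _ _ hx0 (by simp)]
        congr 1; ring
    _ ≤ _ := by rw [mul_comm]; gcongr

noncomputable def FF (β : ℝ) (x : Fin 2 → ℝ) : ℝ≥0∞ :=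
  ENNReal.ofReal |x 0| ^ (-β) * ENNReal.ofReal |x 1| ^ (-β)

noncomputable def om (α : ℝ) (v : Fin 2 → ℝ) : ℝ≥0∞ :=
  ENNReal.ofReal ((1 + v 0 ^ 2) ^ (-α / 2)) * ENNReal.ofReal ((1 + v 1 ^ 2) ^ (-α / 2))

@[fun_prop]
lemma measurable_FF (β : ℝ) : Measurable (FF β) := by unfold FF; fun_prop

@[fun_prop]
lemma measurable_om (α : ℝ) : Measurable (om α) := by unfold om; fun_prop

lemma lintegral_two (f g : ℝ → ℝ≥0∞) (hf : Measurable f) (hg : Measurable g) :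
    ∫⁻ v : Fin 2 → ℝ, f (v 0) * g (v 1) = (∫⁻ s, f s) * ∫⁻ s, g s := by
  have := (volume_preserving_finTwoArrow ℝ).lintegral_comp (f := fun p : ℝ × ℝ => f p.1 * g p.2)
    (by fun_prop)
  rw [← lintegral_prod_mul hf.aemeasurable hg.aemeasurable]
  exact this

lemma FF_om_split (α β : ℝ) (x : Fin 2 → ℝ) :
    ∫⁻ v : Fin 2 → ℝ, FF β (x - v) * om α v =
      (∫⁻ v : ℝ, ENNReal.ofReal |x 0 - v| ^ (-β) * ENNReal.ofReal ((1 + v ^ 2) ^ (-α / 2))) *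
      (∫⁻ v : ℝ, ENNReal.ofReal |x 1 - v| ^ (-β) * ENNReal.ofReal ((1 + v ^ 2) ^ (-α / 2))) := by
  rw [← lintegral_two _ _ (by fun_prop) (by fun_prop)]
  congr 1; ext v
  simp only [FF, om, Pi.sub_apply]
  ring

lemma claimB2 (α β : ℝ) (hα : 0 < α) (hβ : 0 < β) (hβ1 : β < 1) (h : 1 < α + β) :
    ∃ C : ℝ≥0∞, C ≠ ⊤ ∧ ∀ x : Fin 2 → ℝ, ∫⁻ v : Fin 2 → ℝ, FF β (x - v) * om α v ≤ C := by
  obtain ⟨C, hC, hh⟩ := claimB1 α β hα hβ hβ1 h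
  refine ⟨C * C, ENNReal.mul_ne_top hC hC, fun x => ?_⟩
  rw [FF_om_split]
  exact mul_le_mul' (hh _) (hh _)

lemma claimA2 (α β : ℝ) (hα : 0 < α) (hα1 : α < 1) (hβ : 0 < β) (hβ1 : β < 1) (h : 1 < α + β) :
    ∃ C : ℝ≥0∞, C ≠ ⊤ ∧ ∀ x : Fin 2 → ℝ, ∫⁻ v : Fin 2 → ℝ, FF β (x - v) * om α v ≤
      C * FF (β + α - 1) x := by
  obtain ⟨C, hC, hh⟩ := claimA1 α β hα hα1 hβ hβ1 h
  refine ⟨C * C, ENNReal.mul_ne_top hC hC, fun x => ?_⟩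
  rw [FF_om_split]
  refine (mul_le_mul' (hh _) (hh _)).trans (le_of_eq ?_)
  simp only [FF]; ring

lemma conv_bound (α : ℝ) (hα : 0 < α) (hα1 : α < 1) (N : ℕ) :
    ∀ β : ℝ, 0 < β → β < 1 → (N + 1) * (1 - α) < β →
    ∃ C : ℝ≥0∞, C ≠ ⊤ ∧ ∀ x : Fin 2 → ℝ, ∫⁻ v : Fin (N + 1) → Fin 2 → ℝ,
      FF β (x - ∑ i, v i) * ∏ i, om α (v i) ≤ C := by
  induction N with
  | zero =>
    intro β hβ hβ1 h
    obtain ⟨C, hC, hh⟩ := claimB2 α β hα hβ hβ1 (by norm_num at h; linarith)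
    refine ⟨C, hC, fun x => ?_⟩
    refine le_trans (le_of_eq ?_) (hh x)
    have := (volume_preserving_funUnique (Fin 1) (Fin 2 → ℝ)).lintegral_comp
      (f := fun v => FF β (x - v) * om α v) (by fun_prop)
    rw [← this]
    simp
    rfl
  | succ N ih =>
    intro β hβ hβ1 h
    push_cast at h
    have hN : (0 : ℝ) ≤ N := N.cast_nonneg
    have hNN : 0 ≤ (N : ℝ) * (1 - α) := mul_nonneg hN (by linarith)
    obtain ⟨C₁, hC₁, h₁⟩ := claimA2 α β hα hα1 hβ hβ1 (by nlinarith)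
    obtain ⟨C₂, hC₂, h₂⟩ := ih (β + α - 1) (by nlinarith) (by linarith) (by nlinarith)
    refine ⟨C₁ * C₂, ENNReal.mul_ne_top hC₁ hC₂, fun x => ?_⟩
    have e := ((volume_preserving_piFinSuccAbove (fun _ : Fin (N + 1 + 1) => Fin 2 → ℝ) 0).symm).lintegral_comp
      (f := fun v => FF β (x - ∑ i, v i) * ∏ i, om α (v i)) (by fun_prop)
    rw [← e, Measure.volume_eq_prod, lintegral_prod_symm _ (by fun_prop)]
    calc _ = ∫⁻ w : Fin (N + 1) → Fin 2 → ℝ, (∫⁻ v : Fin 2 → ℝ, FF β ((x - ∑ i, w i) - v) * om α v) * ∏ i, om α (w i) := by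
          congr 1; ext w
          rw [← lintegral_mul_const _ (by fun_prop)]
          congr 1; ext v
          simp [Fin.sum_univ_succ, Fin.prod_univ_succ, MeasurableEquiv.piFinSuccAbove, sub_sub, add_comm, mul_assoc]
      _ ≤ ∫⁻ w : Fin (N + 1) → Fin 2 → ℝ, C₁ * (FF (β + α - 1) (x - ∑ i, w i) * ∏ i, om α (w i)) := by
          apply lintegral_mono
          intro w
          simp only [← mul_assoc]
          gcongr
          exact h₁ _
      _ ≤ _ := by
          rw [lintegral_const_mul _ (by fun_prop)]
          gcongr
          exact h₂ x

noncomputable def sq2 (x : Fin 2 → ℝ) : ℝ := ∑ i, x i ^ 2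

@[fun_prop]
lemma continuous_sq2 : Continuous sq2 := by unfold sq2; fun_prop

@[fun_prop]
lemma measurable_sq2 : Measurable sq2 := continuous_sq2.measurable

lemma sq2_nonneg (x : Fin 2 → ℝ) : 0 ≤ sq2 x := Finset.sum_nonneg fun _ _ => sq_nonneg _

noncomputable def brw (α : ℝ) (x : Fin 2 → ℝ) : ℝ≥0∞ := ENNReal.ofReal ((1 + sq2 x) ^ α)

@[fun_prop]
lemma measurable_brw (α : ℝ) : Measurable (brw α) := by unfold brw; fun_prop

/-- put `s` in the coordinate `c` and `r` in the other one -/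
def twoMap (c : Fin 2) (x : ℝ × ℝ) : Fin 2 → ℝ := if c = 0 then ![x.1, x.2] else ![x.2, x.1]

lemma twoMap_mp (c : Fin 2) : MeasurePreserving (twoMap c) volume volume := by
  have h0 : MeasurePreserving (fun x : ℝ × ℝ => ![x.1, x.2]) volume volume :=
    (volume_preserving_finTwoArrow ℝ).symm
  fin_cases c
  · exact h0
  · exact h0.comp Measure.measurePreserving_swap

def bigMap (N : ℕ) (b : Fin (N + 2)) (c : Fin 2) (x : (ℝ × (Fin (N + 1) → Fin 2 → ℝ)) × ℝ) :
    Fin (N + 2) → Fin 2 → ℝ := b.insertNth (α := fun _ => Fin 2 → ℝ) (twoMap c (x.2, x.1.1)) x.1.2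

lemma bigMap_mp (N : ℕ) (b : Fin (N + 2)) (c : Fin 2) :
    MeasurePreserving (bigMap N b c) volume volume := by
  have h1 : MeasurePreserving (fun x : (ℝ × (Fin (N + 1) → Fin 2 → ℝ)) × ℝ => (x.2, x.1)) volume volume :=
    Measure.measurePreserving_swap
  have h2 : MeasurePreserving (fun x : ℝ × (ℝ × (Fin (N + 1) → Fin 2 → ℝ)) => ((x.1, x.2.1), x.2.2)) volume volume :=
    (volume_preserving_prodAssoc (α₁ := ℝ) (β₁ := ℝ) (γ₁ := Fin (N + 1) → Fin 2 → ℝ)).symm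
  have h3 : MeasurePreserving (Prod.map (twoMap c) (id : (Fin (N + 1) → Fin 2 → ℝ) → _)) volume volume :=
    (twoMap_mp c).prod (MeasurePreserving.id _)
  have h4 := (volume_preserving_piFinSuccAbove (fun _ : Fin (N + 2) => Fin 2 → ℝ) b).symm
  exact h4.comp (h3.comp (h2.comp h1))

lemma om_brw (α : ℝ) (hα : 0 < α) (v : Fin 2 → ℝ) : 1 ≤ om α v * brw α v := by
  have h := sq2_nonneg v
  rw [om, brw, ← ENNReal.ofReal_mul (by positivity), ← ENNReal.ofReal_mul (by positivity),
    ← ENNReal.ofReal_one]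
  apply ENNReal.ofReal_le_ofReal
  have hb : (1 + sq2 v) = 1 + v 0 ^ 2 + v 1 ^ 2 := by simp [sq2, Fin.sum_univ_two]; ring
  have h1 : (1 + sq2 v) ^ (-α / 2) ≤ (1 + v 0 ^ 2) ^ (-α / 2) :=
    Real.rpow_le_rpow_of_nonpos (by positivity) (by rw [hb]; nlinarith [sq_nonneg (v 1)]) (by linarith)
  have h2 : (1 + sq2 v) ^ (-α / 2) ≤ (1 + v 1 ^ 2) ^ (-α / 2) :=
    Real.rpow_le_rpow_of_nonpos (by positivity) (by rw [hb]; nlinarith [sq_nonneg (v 0)]) (by linarith)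
  calc (1 : ℝ) = (1 + sq2 v) ^ (-α / 2) * (1 + sq2 v) ^ (-α / 2) * (1 + sq2 v) ^ α := by
        rw [← Real.rpow_add (by positivity), ← Real.rpow_add (by positivity)]
        rw [show -α / 2 + -α / 2 + α = 0 by ring, Real.rpow_zero]
    _ ≤ _ := by gcongr

lemma r_brw (α : ℝ) (hα : 0 < α) (c : Fin 2) (s r : ℝ) :
    1 ≤ ENNReal.ofReal ((1 + r ^ 2) ^ (-(2 * α) / 2)) * brw α (twoMap c (s, r)) := by
  have h := sq2_nonneg (twoMap c (s, r))
  rw [brw, ← ENNReal.ofReal_mul (by positivity), ← ENNReal.ofReal_one]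
  apply ENNReal.ofReal_le_ofReal
  have hb : sq2 (twoMap c (s, r)) = s ^ 2 + r ^ 2 := by
    fin_cases c <;> simp [sq2, twoMap, Fin.sum_univ_two, add_comm]
  rw [hb]
  calc (1 : ℝ) = (1 + r ^ 2) ^ (-(2 * α) / 2) * (1 + r ^ 2) ^ α := by
        rw [← Real.rpow_add (by positivity)]
        rw [show -(2 * α) / 2 + α = 0 by ring, Real.rpow_zero]
    _ ≤ _ := by gcongr; nlinarith [sq_nonneg s]

lemma FF_bound (y : Fin 2 → ℝ) (c : Fin 2) (hy : ∀ i, |y i| ≤ |y c|) :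
    (FF (1 / 2) y)⁻¹ ≤ ENNReal.ofReal |y c| := by
  have key : ∀ i, ENNReal.ofReal |y c| ^ (-(1/2) : ℝ) ≤ ENNReal.ofReal |y i| ^ (-(1/2) : ℝ) := by
    intro i
    rw [ENNReal.rpow_neg, ENNReal.rpow_neg, ENNReal.inv_le_inv]
    exact ENNReal.rpow_le_rpow (ENNReal.ofReal_le_ofReal (hy i)) (by norm_num)
  rw [ENNReal.inv_le_iff_inv_le, FF]
  refine le_trans ?_ (mul_le_mul' (key 0) (key 1))
  by_cases h : ENNReal.ofReal |y c| = 0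
  · rw [h, ENNReal.zero_rpow_of_neg (by norm_num)]; simp
  · rw [← ENNReal.rpow_add _ _ h (by simp)]; norm_num
    rw [ENNReal.rpow_neg_one]

set_option maxHeartbeats 1000000 in
lemma core2c (α : ℝ) (hα : 1 / 2 < α) (hα1 : α < 1) (N : ℕ) (hN : (N + 1) * (1 - α) < 1 / 2) :
    ∃ K : ℝ≥0∞, K ≠ ⊤ ∧ ∀ (ξ : Fin 2 → ℝ) (b : Fin (N + 2)) (c : Fin 2) (ε₀ : ℝ) (ε : Fin (N + 2) → ℝ)
      (g : (Fin (N + 2) → Fin 2 → ℝ) → ℂ), |ε₀| = 1 → ε b = - ε₀ → Measurable g → Integrable g →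
      (∀ u, g u ≠ 0 → ∀ i, |(ξ - ∑ j, u (b.succAbove j)) i| ≤ |(ξ - ∑ j, u (b.succAbove j)) c|) →
      ∫⁻ t : ℝ, ‖∫ u : Fin (N + 2) → Fin 2 → ℝ, Complex.exp (-Complex.I * t *
        ((ε₀ * sq2 (ξ - ∑ j, u j) + ∑ j, ε j * sq2 (u j) : ℝ) : ℂ)) * g u‖ₑ ^ 2 ≤
      K * ∫⁻ u : Fin (N + 2) → Fin 2 → ℝ, (∏ j, brw α (u j)) * ‖g u‖ₑ ^ 2 := by
  obtain ⟨C, hC, hCb⟩ := conv_bound α (by linarith) hα1 N (1 / 2) (by norm_num) (by norm_num) hN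
  have hR := ((tail_int (2 * α) (by linarith)).lintegral_lt_top).ne
  set R := ∫⁻ y : ℝ, ENNReal.ofReal ((1 + y ^ 2) ^ (-(2 * α) / 2)) with hRdef
  refine ⟨R * C * ENNReal.ofReal Real.pi, ENNReal.mul_ne_top (ENNReal.mul_ne_top hR hC) (by simp), ?_⟩
  intro ξ b c ε₀ ε g hε₀ hεb hgm hg hgs
  have mp := bigMap_mp N b c
  -- the data
  set D : ℝ × (Fin (N + 1) → Fin 2 → ℝ) → ℝ≥0∞ := fun m =>
    ENNReal.ofReal ((1 + m.1 ^ 2) ^ (-(2 * α) / 2)) * ∏ i, om α (m.2 i) with hD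
  set W : ℝ × (Fin (N + 1) → Fin 2 → ℝ) → ℝ≥0∞ := fun m =>
    ENNReal.ofReal ((1 + m.1 ^ 2) ^ (-(2 * α) / 2)) * (FF (1 / 2) (ξ - ∑ i, m.2 i) * ∏ i, om α (m.2 i)) with hW
  have om0 : ∀ v, om α v ≠ 0 := by
    intro v
    rw [om, ← ENNReal.ofReal_mul (by positivity)]
    have : 0 < (1 + v 0 ^ 2) ^ (-α / 2) * (1 + v 1 ^ 2) ^ (-α / 2) := by positivity
    simpa using this
  have omt : ∀ v, om α v ≠ ⊤ := by
    intro v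
    rw [om]; exact ENNReal.mul_ne_top (by simp) (by simp)
  have hD0 : ∀ m, D m ≠ 0 := by
    intro m
    have : 0 < (1 + m.1 ^ 2) ^ (-(2 * α) / 2) := by positivity
    refine mul_ne_zero (by simpa using this) ?_
    exact Finset.prod_ne_zero_iff.2 fun i _ => om0 _
  have hDt : ∀ m, D m ≠ ⊤ := by
    intro m
    exact ENNReal.mul_ne_top (by simp) (ENNReal.prod_ne_top fun i _ => omt _)
  have hWD : ∀ m, W m = D m * FF (1 / 2) (ξ - ∑ i, m.2 i) := by
    intro m; simp only [hW, hD]; ring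
  have hW0 : ∀ m, W m ≠ 0 := by
    intro m
    rw [hWD]
    refine mul_ne_zero (hD0 m) ?_
    rw [FF]
    refine mul_ne_zero ?_ ?_ <;> simp [ENNReal.rpow_eq_zero_iff]
  have hWm : Measurable W := by simp only [hW]; fun_prop
  have hWint : ∫⁻ m, W m ≤ R * C := by
    rw [Measure.volume_eq_prod]
    simp only [hW]
    rw [lintegral_prod_mul (f := fun y : ℝ => ENNReal.ofReal ((1 + y ^ 2) ^ (-(2 * α) / 2)))
      (g := fun v : Fin (N + 1) → Fin 2 → ℝ => (FF (1 / 2) (ξ - ∑ i, v i) * ∏ i, om α (v i))) (by fun_prop) (by fun_prop)]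
    gcongr
    exact hCb ξ
  have hWt : ∫⁻ m, W m ≠ ⊤ := ne_top_of_le_ne_top (ENNReal.mul_ne_top hR hC) hWint
  set l : ℝ × (Fin (N + 1) → Fin 2 → ℝ) → ℝ := fun m => - 2 * ε₀ * (ξ - ∑ i, m.2 i) c with hl
  set cc : ℝ × (Fin (N + 1) → Fin 2 → ℝ) → ℝ := fun m =>
    ε₀ * (sq2 (ξ - ∑ i, m.2 i) - 2 * (ξ - ∑ i, m.2 i) (1 - c) * m.1) +
      ∑ i, ε (b.succAbove i) * sq2 (m.2 i) with hcc
  have hphase : ∀ x, ε₀ * sq2 (ξ - ∑ j, bigMap N b c x j) + ∑ j, ε j * sq2 (bigMap N b c x j) =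
      cc x.1 + l x.1 * x.2 := by
    intro x
    rw [Fin.sum_univ_succAbove _ b, Fin.sum_univ_succAbove _ b]
    simp only [bigMap, Fin.insertNth_apply_same, Fin.insertNth_apply_succAbove, hεb, hcc, hl]
    rw [add_comm (twoMap c _), ← sub_sub]
    set y := ξ - ∑ i, x.1.2 i
    fin_cases c <;> simp [twoMap, sq2, Fin.sum_univ_two] <;> ring
  have hcm : Measurable cc := by
    have : Measurable (fun m : ℝ × (Fin (N + 1) → Fin 2 → ℝ) => (ξ - ∑ i, m.2 i)) := by fun_prop
    have h2 := (measurable_pi_iff.1 this (1 - c))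
    simp only [hcc]
    fun_prop
  have hlm : Measurable l := by
    have : Measurable (fun m : ℝ × (Fin (N + 1) → Fin 2 → ℝ) => (ξ - ∑ i, m.2 i)) := by fun_prop
    have h2 := (measurable_pi_iff.1 this c)
    simp only [hl]
    fun_prop
  have main := core1 volume cc l hcm hlm (fun x => g (bigMap N b c x)) (hgm.comp mp.measurable)
    ((mp.integrable_comp hg.aestronglyMeasurable).2 hg) W hWm hW0 hWt
  have hL : ∀ t : ℝ, ∫ u : Fin (N + 2) → Fin 2 → ℝ, Complex.exp (-Complex.I * t *
        ((ε₀ * sq2 (ξ - ∑ j, u j) + ∑ j, ε j * sq2 (u j) : ℝ) : ℂ)) * g u =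
      ∫ x : (ℝ × (Fin (N + 1) → Fin 2 → ℝ)) × ℝ,
        Complex.exp (-Complex.I * t * ((cc x.1 + l x.1 * x.2 : ℝ) : ℂ)) * g (bigMap N b c x) ∂(volume.prod volume) := by
    intro t
    have hm : Measurable (fun u : Fin (N + 2) → Fin 2 → ℝ => Complex.exp (-Complex.I * t *
        ((ε₀ * sq2 (ξ - ∑ j, u j) + ∑ j, ε j * sq2 (u j) : ℝ) : ℂ)) * g u) := by fun_prop
    rw [← mp.map_eq, integral_map mp.measurable.aemeasurable hm.aestronglyMeasurable]
    simp only [hphase]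
    rfl
  simp only [hL]
  refine main.trans ?_
  have hRR : ∫⁻ u : Fin (N + 2) → Fin 2 → ℝ, (∏ j, brw α (u j)) * ‖g u‖ₑ ^ 2 =
      ∫⁻ x, (∏ j, brw α (bigMap N b c x j)) * ‖g (bigMap N b c x)‖ₑ ^ 2 ∂(volume.prod volume) :=
    (mp.lintegral_comp (f := fun u => (∏ j, brw α (u j)) * ‖g u‖ₑ ^ 2) (by fun_prop)).symm
  rw [hRR, mul_assoc (R * C), ← lintegral_const_mul' (ENNReal.ofReal Real.pi) _ (by simp)]
  refine mul_le_mul' hWint (lintegral_mono fun x => ?_)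
  simp only
  rw [← mul_assoc]
  by_cases hgx : g (bigMap N b c x) = 0
  · simp [hgx]
  have hs := hgs _ hgx
  simp only [bigMap, Fin.insertNth_apply_succAbove] at hs
  gcongr ?_ * _
  have hFF := FF_bound (ξ - ∑ i, x.1.2 i) c hs
  set y := ξ - ∑ i, x.1.2 i with hy
  have hll : |l x.1| = 2 * |y c| := by
    simp only [hl]; rw [abs_mul, abs_mul, hε₀]; simp [hy]
  have hDP : 1 ≤ D x.1 * ∏ j, brw α (bigMap N b c x j) := by
    rw [Fin.prod_univ_succAbove _ b]
    simp only [bigMap, Fin.insertNth_apply_same, Fin.insertNth_apply_succAbove, hD]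
    calc (1 : ℝ≥0∞) = 1 * ∏ i : Fin (N + 1), 1 := by simp
      _ ≤ _ * ∏ i, (om α (x.1.2 i) * brw α (x.1.2 i)) :=
        mul_le_mul' (r_brw α (by linarith) c x.2 x.1.1) (Finset.prod_le_prod' fun i _ => om_brw α (by linarith) _)
      _ = _ := by rw [Finset.prod_mul_distrib]; ring
  have hDinv : (D x.1)⁻¹ ≤ ∏ j, brw α (bigMap N b c x j) := by
    calc (D x.1)⁻¹ = (D x.1)⁻¹ * 1 := by simp
      _ ≤ (D x.1)⁻¹ * (D x.1 * ∏ j, brw α (bigMap N b c x j)) := by gcongr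
      _ = _ := by rw [← mul_assoc, ENNReal.inv_mul_cancel (hD0 _) (hDt _), one_mul]
  rw [hWD, ENNReal.mul_inv (Or.inl (hD0 _)) (Or.inl (hDt _)), hll, ENNReal.ofReal_mul (by norm_num),
    ENNReal.ofReal_mul (by norm_num), ENNReal.mul_div_mul_left _ _ (by simp) (by simp), mul_assoc, mul_comm]
  refine mul_le_mul' ?_ hDinv
  refine (mul_le_mul_left hFF _).trans ?_
  exact ENNReal.mul_div_le

lemma enorm_sum_sq {ι : Type*} [Fintype ι] (z : ι → ℂ) :
    ‖∑ i, z i‖ₑ ^ 2 ≤ (Fintype.card ι : ℝ≥0∞) * ∑ i, ‖z i‖ₑ ^ 2 := by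
  have h1 : ‖∑ i, z i‖₊ ^ 2 ≤ (Fintype.card ι : NNReal) * ∑ i, ‖z i‖₊ ^ 2 := by
    refine (pow_le_pow_left' (nnnorm_sum_le _ _) 2).trans ?_
    exact sq_sum_le_card_mul_sum_sq
  simp only [enorm_eq_nnnorm]
  exact_mod_cast h1

lemma meas_osc {U : Type*} [MeasurableSpace U] (μ : Measure U) [SFinite μ] (φ : U → ℝ)
    (hφ : Measurable φ) (g : U → ℂ) (hg : Measurable g) :
    Measurable fun t : ℝ => ∫ u, Complex.exp (-Complex.I * t * (φ u : ℂ)) * g u ∂μ := by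
  have : StronglyMeasurable (fun x : ℝ × U => Complex.exp (-Complex.I * x.1 * (φ x.2 : ℂ)) * g x.2) := by
    apply Measurable.stronglyMeasurable; fun_prop
  exact this.integral_prod_right'.measurable

lemma integrable_osc {U : Type*} [MeasurableSpace U] (μ : Measure U) (φ : U → ℝ)
    (hφ : Measurable φ) (g : U → ℂ) (hgi : Integrable g μ) (t : ℝ) :
    Integrable (fun u => Complex.exp (-Complex.I * t * (φ u : ℂ)) * g u) μ := by
  refine hgi.bdd_mul (c := 1) (by fun_prop) ?_
  refine Filter.Eventually.of_forall fun u => ?_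
  rw [show -Complex.I * t * (φ u : ℂ) = ((-(t * φ u) : ℝ) : ℂ) * Complex.I by push_cast; ring,
    Complex.norm_exp_ofReal_mul_I]

lemma split_bound {ι : Type*} [Fintype ι] {U : Type*} [MeasurableSpace U] (μ : Measure U) [SFinite μ]
    (φ : U → ℝ) (hφ : Measurable φ) (g : U → ℂ) (G : ι → U → ℂ) (hG : ∀ i, Measurable (G i))
    (hGi : ∀ i, Integrable (G i) μ) (hs : ∀ u, g u = ∑ i, G i u) :
    ∫⁻ t : ℝ, ‖∫ u, Complex.exp (-Complex.I * t * (φ u : ℂ)) * g u ∂μ‖ₑ ^ 2 ≤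
      (Fintype.card ι : ℝ≥0∞) * ∑ i, ∫⁻ t : ℝ, ‖∫ u, Complex.exp (-Complex.I * t * (φ u : ℂ)) * G i u ∂μ‖ₑ ^ 2 := by
  rw [← lintegral_finsetSum, ← lintegral_const_mul' _ _ (by simp)]
  · refine lintegral_mono fun t => ?_
    simp only [hs, Finset.mul_sum]
    rw [integral_finsetSum]
    · refine (enorm_sum_sq _).trans ?_
      rw [Finset.mul_sum]
    · intro i _
      exact integrable_osc μ φ hφ _ (hGi i) t
  · intro i _
    have := meas_osc μ φ hφ (G i) (hG i)
    fun_prop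

lemma core2 (α : ℝ) (hα : 1 / 2 < α) (hα1 : α < 1) (N : ℕ) (hN : (N + 1) * (1 - α) < 1 / 2) :
    ∃ K : ℝ≥0∞, K ≠ ⊤ ∧ ∀ (ξ : Fin 2 → ℝ) (b : Fin (N + 2)) (ε₀ : ℝ) (ε : Fin (N + 2) → ℝ)
      (g : (Fin (N + 2) → Fin 2 → ℝ) → ℂ), |ε₀| = 1 → ε b = - ε₀ → Measurable g → Integrable g →
      ∫⁻ t : ℝ, ‖∫ u : Fin (N + 2) → Fin 2 → ℝ, Complex.exp (-Complex.I * t *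
        ((ε₀ * sq2 (ξ - ∑ j, u j) + ∑ j, ε j * sq2 (u j) : ℝ) : ℂ)) * g u‖ₑ ^ 2 ≤
      K * ∫⁻ u : Fin (N + 2) → Fin 2 → ℝ, (∏ j, brw α (u j)) * ‖g u‖ₑ ^ 2 := by
  obtain ⟨K, hK, h⟩ := core2c α hα hα1 N hN
  refine ⟨4 * K, ENNReal.mul_ne_top (by simp) hK, ?_⟩
  intro ξ b ε₀ ε g h1 h2 hgm hg
  let y : (Fin (N + 2) → Fin 2 → ℝ) → Fin 2 → ℝ := fun u => ξ - ∑ j, u (b.succAbove j)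
  have hy : Measurable y := by fun_prop
  have hy0 : Measurable fun u => |y u 0| := by
    have := measurable_pi_iff.1 hy 0
    simpa using this.norm
  have hy1 : Measurable fun u => |y u 1| := by
    have := measurable_pi_iff.1 hy 1
    simpa using this.norm
  let R : Set (Fin (N + 2) → Fin 2 → ℝ) := {u | |y u 1| ≤ |y u 0|}
  have hR : MeasurableSet R := measurableSet_le hy1 hy0
  let G : Fin 2 → (Fin (N + 2) → Fin 2 → ℝ) → ℂ := ![R.indicator g, Rᶜ.indicator g]
  have hGle : ∀ i u, ‖G i u‖ₑ ^ 2 ≤ ‖g u‖ₑ ^ 2 := by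
    intro i u
    gcongr
    fin_cases i <;> simp only [G, enorm_eq_nnnorm, ENNReal.coe_le_coe] <;>
      exact norm_indicator_le_norm_self g u
  have hGm : ∀ i, Measurable (G i) := by
    intro i
    fin_cases i
    · exact hgm.indicator hR
    · exact hgm.indicator hR.compl
  have hGi : ∀ i, Integrable (G i) := by
    intro i
    fin_cases i
    · exact hg.indicator hR
    · exact hg.indicator hR.compl
  have := split_bound volume (fun u => (ε₀ * sq2 (ξ - ∑ j, u j) + ∑ j, ε j * sq2 (u j) : ℝ)) (by fun_prop)
    g G hGm hGi (fun u => by simp [G, Fin.sum_univ_two])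
  refine this.trans ?_
  have hb : ∀ i, ∫⁻ t : ℝ, ‖∫ u : Fin (N + 2) → Fin 2 → ℝ, Complex.exp (-Complex.I * t *
        ((ε₀ * sq2 (ξ - ∑ j, u j) + ∑ j, ε j * sq2 (u j) : ℝ) : ℂ)) * G i u‖ₑ ^ 2 ≤
      K * ∫⁻ u : Fin (N + 2) → Fin 2 → ℝ, (∏ j, brw α (u j)) * ‖g u‖ₑ ^ 2 := by
    intro i
    refine (h ξ b i ε₀ ε (G i) h1 h2 (hGm i) (hGi i) ?_).trans ?_
    · intro u hu
      fin_cases i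
      · have hu : u ∈ R := by
          by_contra hc; exact hu (Set.indicator_of_notMem hc g)
        intro i
        fin_cases i
        · exact le_rfl
        · exact hu
      · have hu : u ∈ Rᶜ := by
          by_contra hc; exact hu (Set.indicator_of_notMem hc g)
        intro i
        fin_cases i
        · exact (not_le.1 (show ¬ (|y u 1| ≤ |y u 0|) from hu)).le
        · exact le_rfl
    · exact mul_le_mul_right (lintegral_mono fun u => mul_le_mul_right (hGle i u) _) _
  refine (mul_le_mul_right (Finset.sum_le_sum fun i _ => hb i) _).trans ?_
  simp only [Finset.sum_const, Finset.card_univ, Fintype.card_fin, nsmul_eq_mul]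
  rw [← mul_assoc, ← mul_assoc]
  norm_num

noncomputable def swapMap (N : ℕ) (ξ : Fin 2 → ℝ) (a : Fin (N + 2)) (u : Fin (N + 2) → Fin 2 → ℝ) :
    Fin (N + 2) → Fin 2 → ℝ := Function.update u a (ξ - ∑ j, u j)

lemma swapMap_mp (N : ℕ) (ξ : Fin 2 → ℝ) (a : Fin (N + 2)) :
    MeasurePreserving (swapMap N ξ a) volume volume := by
  have h4 := (volume_preserving_piFinSuccAbove (fun _ : Fin (N + 2) => Fin 2 → ℝ) a)
  have h1 : MeasurePreserving (fun x : (Fin (N + 1) → Fin 2 → ℝ) × (Fin 2 → ℝ) => (x.1, (ξ - ∑ j, x.1 j) - x.2))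
      (volume.prod volume) (volume.prod volume) := by
    refine MeasurePreserving.skew_product (g := fun (v : Fin (N + 1) → Fin 2 → ℝ) (x : Fin 2 → ℝ) => (ξ - ∑ j, v j) - x)
      (MeasurePreserving.id _) (by fun_prop) ?_
    refine Filter.Eventually.of_forall fun v => ?_
    exact (Measure.measurePreserving_sub_left volume (ξ - ∑ j, v j)).map_eq
  have hs : MeasurePreserving (Prod.swap : (Fin 2 → ℝ) × (Fin (N + 1) → Fin 2 → ℝ) → _) (volume.prod volume) (volume.prod volume) := Measure.measurePreserving_swap
  have hs' : MeasurePreserving (Prod.swap : (Fin (N + 1) → Fin 2 → ℝ) × (Fin 2 → ℝ) → _) (volume.prod volume) (volume.prod volume) := Measure.measurePreserving_swap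
  have h := h4.symm.comp (hs'.comp (h1.comp (hs.comp h4)))
  refine (congrArg (fun F => MeasurePreserving F volume volume) ?_).mpr h
  funext u
  rw [swapMap]
  simp only [Function.comp]
  change _ = a.insertNth (α := fun _ => Fin 2 → ℝ) (ξ - ∑ j, u (a.succAbove j) - u a) (a.removeNth u)
  rw [Fin.insertNth_removeNth, Fin.sum_univ_succAbove _ a]
  congr 1
  abel

noncomputable def allv (N : ℕ) (ξ : Fin 2 → ℝ) (u : Fin (N + 2) → Fin 2 → ℝ) : Option (Fin (N + 2)) → Fin 2 → ℝ
  | none => ξ - ∑ j, u j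
  | some j => u j

lemma measurable_allv (N : ℕ) (ξ : Fin 2 → ℝ) (a) : Measurable fun u => allv N ξ u a := by
  cases a <;> simp only [allv] <;> fun_prop

lemma sum_allv (N : ℕ) (ξ : Fin 2 → ℝ) (u) : ∑ a, allv N ξ u a = ξ := by
  rw [Fintype.sum_option]; simp [allv]

lemma swapMap_sum (N : ℕ) (ξ : Fin 2 → ℝ) (a) (u) : ξ - ∑ j, swapMap N ξ a u j = u a := by
  rw [Fin.sum_univ_succAbove _ a]
  simp only [swapMap, Function.update_self, Function.update_of_ne (Fin.succAbove_ne a _)]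
  rw [Fin.sum_univ_succAbove _ a]; abel

lemma swapMap_self (N : ℕ) (ξ : Fin 2 → ℝ) (a) (u) : swapMap N ξ a u a = ξ - ∑ j, u j := by
  simp [swapMap]

lemma swapMap_succ (N : ℕ) (ξ : Fin 2 → ℝ) (a) (u) (i) : swapMap N ξ a u (a.succAbove i) = u (a.succAbove i) := by
  simp [swapMap]

/-- key pointwise bound -/
lemma peetre (α : ℝ) (h0 : 0 < α) (h1 : α < 1) {ι : Type*} [Fintype ι] [Nonempty ι] (v : ι → Fin 2 → ℝ) :
    (1 + sq2 (∑ a, v a)) ^ α ≤ (Fintype.card ι : ℝ) ^ 2 * ∑ a, (1 + sq2 (v a)) ^ α := by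
  have hn : (1 : ℝ) ≤ Fintype.card ι := by exact_mod_cast Fintype.card_pos
  set n : ℝ := (Fintype.card ι : ℝ) with hnd
  have hsq : sq2 (∑ a, v a) ≤ n * ∑ a, sq2 (v a) := by
    unfold sq2
    rw [Finset.sum_comm, Finset.mul_sum]
    refine Finset.sum_le_sum fun i _ => ?_
    rw [Finset.sum_apply]
    exact sq_sum_le_card_mul_sum_sq
  have h2 : ∑ a : ι, (1 + sq2 (∑ a, v a)) / n ≤ ∑ a, n * (1 + sq2 (v a)) := by
    rw [Finset.sum_const, Finset.card_univ, nsmul_eq_mul, mul_div_cancel₀ _ (by positivity), ← Finset.mul_sum,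
      Finset.sum_add_distrib, mul_add]
    simp only [Finset.sum_const, Finset.card_univ, nsmul_eq_mul, mul_one, ← hnd]
    nlinarith
  obtain ⟨a, -, ha⟩ := Finset.exists_le_of_sum_le Finset.univ_nonempty h2
  have hp : ∀ x, 0 < 1 + sq2 x := fun x => by have := sq2_nonneg x; linarith
  have h3 : 1 + sq2 (∑ a, v a) ≤ n ^ 2 * (1 + sq2 (v a)) := by
    rw [div_le_iff₀ (by positivity)] at ha; linarith
  calc (1 + sq2 (∑ a, v a)) ^ α ≤ (n ^ 2 * (1 + sq2 (v a))) ^ α :=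
        Real.rpow_le_rpow (hp _).le h3 h0.le
    _ = (n ^ 2) ^ α * (1 + sq2 (v a)) ^ α := Real.mul_rpow (by positivity) (hp _).le
    _ ≤ (n ^ 2) ^ (1 : ℝ) * (1 + sq2 (v a)) ^ α := by
        have := (hp (v a)).le
        refine mul_le_mul_of_nonneg_right ?_ (Real.rpow_nonneg this _)
        exact Real.rpow_le_rpow_of_exponent_le (by nlinarith) h1.le
    _ ≤ _ := by
        rw [Real.rpow_one]
        gcongr
        exact Finset.single_le_sum (f := fun a => (1 + sq2 (v a)) ^ α) (fun i _ => Real.rpow_nonneg (hp _).le _) (Finset.mem_univ a)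

set_option maxHeartbeats 1000000 in
lemma core3 (α : ℝ) (hα : 1 / 2 < α) (hα1 : α < 1) (N : ℕ) (hN : (N + 1) * (1 - α) < 1 / 2) :
    ∃ K : ℝ≥0∞, K ≠ ⊤ ∧ ∀ (ξ : Fin 2 → ℝ) (b : Fin (N + 2)) (ε₀ : ℝ) (ε : Fin (N + 2) → ℝ)
      (g : (Fin (N + 2) → Fin 2 → ℝ) → ℂ), |ε₀| = 1 → (∀ j, |ε j| = 1) → ε b = - ε₀ → Measurable g → Integrable g →
      brw α ξ * ∫⁻ t : ℝ, ‖∫ u : Fin (N + 2) → Fin 2 → ℝ, Complex.exp (-Complex.I * t *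
        ((ε₀ * sq2 (ξ - ∑ j, u j) + ∑ j, ε j * sq2 (u j) : ℝ) : ℂ)) * g u‖ₑ ^ 2 ≤
      K * ∫⁻ u : Fin (N + 2) → Fin 2 → ℝ, brw α (ξ - ∑ j, u j) * (∏ j, brw α (u j)) * ‖g u‖ₑ ^ 2 := by
  obtain ⟨K, hK, h⟩ := core2 α hα hα1 N hN
  set n : ℕ := Fintype.card (Option (Fin (N + 2))) with hn
  refine ⟨n * (n * (K * ENNReal.ofReal ((n : ℝ) ^ 2))), ENNReal.mul_ne_top (by simp) (ENNReal.mul_ne_top (by simp) (ENNReal.mul_ne_top hK (by simp))), ?_⟩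
  intro ξ b ε₀ ε g h1 hε h2 hgm hg
  have hp : ∀ x, 0 < 1 + sq2 x := fun x => by have := sq2_nonneg x; linarith
  have hpr : ∀ x, 0 < (1 + sq2 x) ^ α := fun x => Real.rpow_pos_of_pos (hp x) _
  let r : Option (Fin (N + 2)) → (Fin (N + 2) → Fin 2 → ℝ) → ℝ := fun a u => (1 + sq2 (allv N ξ u a)) ^ α
  have hrm : ∀ a, Measurable (r a) := by
    intro a
    have := measurable_allv N ξ a
    simp only [r]; fun_prop
  have hrp : ∀ a u, 0 < r a u := fun a u => hpr _
  have hsp : ∀ u, 0 < ∑ a, r a u := fun u => Finset.sum_pos (fun a _ => hrp a u) Finset.univ_nonempty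
  let θ : Option (Fin (N + 2)) → (Fin (N + 2) → Fin 2 → ℝ) → ℝ := fun a u => r a u / ∑ a', r a' u
  have hθm : ∀ a, Measurable (θ a) := by
    intro a; simp only [θ]; fun_prop
  have hθ0 : ∀ a u, 0 ≤ θ a u := fun a u => (div_pos (hrp a u) (hsp u)).le
  have hθ1 : ∀ a u, θ a u ≤ 1 := fun a u => by
    rw [div_le_one (hsp u)]
    exact Finset.single_le_sum (f := fun a => r a u) (fun i _ => (hrp i u).le) (Finset.mem_univ a)
  have hθs : ∀ u, ∑ a, θ a u = 1 := fun u => by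
    simp only [θ]; rw [← Finset.sum_div, div_self (hsp u).ne']
  have hkey : ∀ a u, (1 + sq2 ξ) ^ α * θ a u ^ 2 ≤ (n : ℝ) ^ 2 * r a u := by
    intro a u
    have hpe := peetre α (by linarith) hα1 (allv N ξ u)
    rw [sum_allv] at hpe
    calc (1 + sq2 ξ) ^ α * θ a u ^ 2 ≤ ((n : ℝ) ^ 2 * ∑ a, r a u) * θ a u ^ 2 := by gcongr
      _ = (n : ℝ) ^ 2 * (r a u * θ a u) := by
          simp only [θ]; have := (hsp u).ne'; field_simp
      _ ≤ (n : ℝ) ^ 2 * (r a u * 1) := by have := (hrp a u).le; gcongr; exact hθ1 a u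
      _ = _ := by ring
  let G : Option (Fin (N + 2)) → (Fin (N + 2) → Fin 2 → ℝ) → ℂ := fun a u => (θ a u : ℂ) * g u
  have hGm : ∀ a, Measurable (G a) := by
    intro a
    have := hθm a
    simp only [G]; fun_prop
  have hGi : ∀ a, Integrable (G a) := by
    intro a
    refine hg.bdd_mul (c := 1) (by have := hθm a; fun_prop) ?_
    refine Filter.Eventually.of_forall fun u => ?_
    rw [Complex.norm_real, Real.norm_of_nonneg (hθ0 a u)]; exact hθ1 a u
  have hGe : ∀ a u, brw α ξ * ‖G a u‖ₑ ^ 2 ≤ ENNReal.ofReal ((n : ℝ) ^ 2) * (brw α (allv N ξ u a) * ‖g u‖ₑ ^ 2) := by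
    intro a u
    simp only [G]
    rw [enorm_mul, mul_pow, ← mul_assoc, ← mul_assoc]
    refine mul_le_mul_left ?_ _
    rw [← ofReal_norm, Complex.norm_real, Real.norm_of_nonneg (hθ0 a u), brw, brw, ← ENNReal.ofReal_pow (hθ0 a u),
      ← ENNReal.ofReal_mul (hpr _).le, ← ENNReal.ofReal_mul (by positivity)]
    exact ENNReal.ofReal_le_ofReal (hkey a u)
  have hsplit := split_bound volume (fun u => (ε₀ * sq2 (ξ - ∑ j, u j) + ∑ j, ε j * sq2 (u j) : ℝ)) (by fun_prop)
    g G hGm hGi (fun u => by simp only [G]; rw [← Finset.sum_mul, ← Complex.ofReal_sum, hθs]; simp)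
  set T := ∫⁻ u : Fin (N + 2) → Fin 2 → ℝ, brw α (ξ - ∑ j, u j) * (∏ j, brw α (u j)) * ‖g u‖ₑ ^ 2 with hT
  -- each piece, up to weights
  have hb : ∀ a, brw α ξ * ∫⁻ t : ℝ, ‖∫ u : Fin (N + 2) → Fin 2 → ℝ, Complex.exp (-Complex.I * t *
        ((ε₀ * sq2 (ξ - ∑ j, u j) + ∑ j, ε j * sq2 (u j) : ℝ) : ℂ)) * G a u‖ₑ ^ 2 ≤
      K * ENNReal.ofReal ((n : ℝ) ^ 2) * T := by
    intro a
    cases a with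
    | none =>
      calc _ ≤ brw α ξ * (K * ∫⁻ u : Fin (N + 2) → Fin 2 → ℝ, (∏ j, brw α (u j)) * ‖G none u‖ₑ ^ 2) := by
            gcongr; exact h ξ b ε₀ ε (G none) h1 h2 (hGm _) (hGi _)
        _ = K * ∫⁻ u : Fin (N + 2) → Fin 2 → ℝ, (∏ j, brw α (u j)) * (brw α ξ * ‖G none u‖ₑ ^ 2) := by
            rw [mul_left_comm, ← lintegral_const_mul' _ _ (by simp [brw])]
            congr 1; refine lintegral_congr fun u => ?_; ring
        _ ≤ K * ∫⁻ u : Fin (N + 2) → Fin 2 → ℝ, (∏ j, brw α (u j)) *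
              (ENNReal.ofReal ((n : ℝ) ^ 2) * (brw α (allv N ξ u none) * ‖g u‖ₑ ^ 2)) := by
            exact mul_le_mul_right (lintegral_mono fun u => mul_le_mul_right (hGe none u) _) _
        _ = _ := by
            rw [hT, mul_assoc, ← lintegral_const_mul' (ENNReal.ofReal ((n : ℝ) ^ 2)) _ (by simp)]
            congr 1; refine lintegral_congr fun u => ?_; simp only [allv]; ring
    | some i =>
      have mp := swapMap_mp N ξ i
      have hsw : ∀ t : ℝ, ∫ u : Fin (N + 2) → Fin 2 → ℝ, Complex.exp (-Complex.I * t *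
        ((ε₀ * sq2 (ξ - ∑ j, u j) + ∑ j, ε j * sq2 (u j) : ℝ) : ℂ)) * G (some i) u =
          ∫ u : Fin (N + 2) → Fin 2 → ℝ, Complex.exp (-Complex.I * t *
        ((ε i * sq2 (ξ - ∑ j, u j) + ∑ j, Function.update ε i ε₀ j * sq2 (u j) : ℝ) : ℂ)) * G (some i) (swapMap N ξ i u) := by
        intro t
        have hGG := hGm (some i)
        have hm : Measurable (fun u : Fin (N + 2) → Fin 2 → ℝ => Complex.exp (-Complex.I * t *
          ((ε₀ * sq2 (ξ - ∑ j, u j) + ∑ j, ε j * sq2 (u j) : ℝ) : ℂ)) * G (some i) u) := by fun_prop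
        conv_lhs => rw [← mp.map_eq]
        rw [integral_map mp.measurable.aemeasurable hm.aestronglyMeasurable]
        refine integral_congr_ae (Filter.Eventually.of_forall fun u => ?_)
        simp only
        congr 4
        rw [swapMap_sum, Fin.sum_univ_succAbove _ i, Fin.sum_univ_succAbove (fun j => Function.update ε i ε₀ j * sq2 (u j)) i]
        simp only [swapMap_self, swapMap_succ, Function.update_self, Function.update_of_ne (Fin.succAbove_ne i _)]
        ring
      have hbb : ∃ b', Function.update ε i ε₀ b' = - ε i := by
        by_cases hc : ε i = - ε₀
        · exact ⟨i, by simp [hc]⟩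
        · have hi := hε i
          have : ε i = ε₀ := by
            rcases abs_eq_abs.1 (hi.trans h1.symm) with h | h
            · exact h
            · exact absurd h hc
          refine ⟨b, ?_⟩
          have hbi : b ≠ i := by rintro rfl; exact hc h2
          rw [Function.update_of_ne hbi, h2, this]
      obtain ⟨b', hb'⟩ := hbb
      simp only [hsw]
      have hgs : Measurable fun u => ‖g u‖ₑ := by fun_prop
      calc _ ≤ brw α ξ * (K * ∫⁻ u : Fin (N + 2) → Fin 2 → ℝ, (∏ j, brw α (u j)) * ‖G (some i) (swapMap N ξ i u)‖ₑ ^ 2) := by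
            gcongr
            exact h ξ b' (ε i) (Function.update ε i ε₀) (fun u => G (some i) (swapMap N ξ i u)) (hε i) hb'
              ((hGm _).comp mp.measurable) ((mp.integrable_comp (hGi _).aestronglyMeasurable).2 (hGi _))
        _ = K * ∫⁻ u : Fin (N + 2) → Fin 2 → ℝ, (∏ j, brw α (u j)) * (brw α ξ * ‖G (some i) (swapMap N ξ i u)‖ₑ ^ 2) := by
            rw [mul_left_comm, ← lintegral_const_mul' _ _ (by simp [brw])]
            congr 1; refine lintegral_congr fun u => ?_; ring
        _ ≤ K * ∫⁻ u : Fin (N + 2) → Fin 2 → ℝ, (∏ j, brw α (u j)) *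
              (ENNReal.ofReal ((n : ℝ) ^ 2) * (brw α (allv N ξ (swapMap N ξ i u) (some i)) * ‖g (swapMap N ξ i u)‖ₑ ^ 2)) := by
            exact mul_le_mul_right (lintegral_mono fun u => mul_le_mul_right (hGe (some i) (swapMap N ξ i u)) _) _
        _ = _ := by
            rw [hT, mul_assoc, ← lintegral_const_mul' (ENNReal.ofReal ((n : ℝ) ^ 2)) _ (by simp)]
            congr 1
            rw [← mp.lintegral_comp (f := fun u => ENNReal.ofReal ((n : ℝ) ^ 2) *
              (brw α (ξ - ∑ j, u j) * (∏ j, brw α (u j)) * ‖g u‖ₑ ^ 2)) (by fun_prop)]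
            refine lintegral_congr fun u => ?_
            rw [swapMap_sum, Fin.prod_univ_succAbove _ i, Fin.prod_univ_succAbove (fun j => brw α (swapMap N ξ i u j)) i]
            simp only [allv, swapMap_self, swapMap_succ]; ring
  calc _ ≤ brw α ξ * _ := mul_le_mul_right hsplit _
    _ = n * ∑ a, brw α ξ * ∫⁻ t : ℝ, ‖∫ u : Fin (N + 2) → Fin 2 → ℝ, Complex.exp (-Complex.I * t *
        ((ε₀ * sq2 (ξ - ∑ j, u j) + ∑ j, ε j * sq2 (u j) : ℝ) : ℂ)) * G a u‖ₑ ^ 2 := by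
        rw [mul_left_comm, Finset.mul_sum]
    _ ≤ n * ∑ a : Option (Fin (N + 2)), K * ENNReal.ofReal ((n : ℝ) ^ 2) * T := by
        exact mul_le_mul_right (Finset.sum_le_sum fun a _ => hb a) _
    _ = _ := by
        rw [Finset.sum_const, Finset.card_univ, nsmul_eq_mul, ← hn]; ring
lemma expI_deriv (n : ℕ) : iteratedDeriv n (fun x : ℝ => Complex.exp (x * Complex.I)) =
    fun x : ℝ => Complex.I ^ n * Complex.exp (x * Complex.I) := by
  induction n with
  | zero => simp
  | succ n ih =>
    rw [iteratedDeriv_succ, ih]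
    funext x
    have h : HasDerivAt (fun x : ℝ => Complex.I ^ n * Complex.exp (x * Complex.I))
        (Complex.I ^ n * (Complex.exp (x * Complex.I) * (1 * Complex.I))) x := by
      apply HasDerivAt.const_mul
      apply HasDerivAt.cexp
      apply HasDerivAt.mul_const
      exact Complex.ofRealCLM.hasDerivAt
    rw [h.deriv]; ring

lemma expI_temperate : Function.HasTemperateGrowth (fun x : ℝ => Complex.exp (x * Complex.I)) := by
  refine ⟨?_, fun n => ⟨0, 1, fun x => ?_⟩⟩
  · have : ContDiff ℝ (⊤ : ℕ∞) (fun x : ℝ => (x : ℂ)) := Complex.ofRealCLM.contDiff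
    fun_prop
  · rw [norm_iteratedFDeriv_eq_norm_iteratedDeriv, expI_deriv]
    simp [Complex.norm_exp_ofReal_mul_I]

lemma restrict_fourier {E E' U : Type*} [NormedAddCommGroup E] [InnerProductSpace ℝ E] [FiniteDimensional ℝ E]
    [MeasurableSpace E] [BorelSpace E] [NormedAddCommGroup E'] [InnerProductSpace ℝ E'] [FiniteDimensional ℝ E']
    [MeasurableSpace E'] [BorelSpace E'] [NormedAddCommGroup U] [NormedSpace ℝ U] [FiniteDimensional ℝ U]
    [MeasureSpace U] [BorelSpace U] [(volume : Measure U).IsAddHaarMeasure]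
    (Θ : E × U → E') (hΘc : Continuous Θ) (hΘ : MeasurePreserving Θ (volume.prod volume) volume)
    (A : E →ₗ[ℝ] E') (hA : Function.Injective A) (hin : ∀ z ζ u, inner ℝ (Θ (ζ, u)) (A z) = inner ℝ ζ z)
    (hn : ∀ ζ u, ‖u‖ ≤ ‖Θ (ζ, u)‖) (G : SchwartzMap E' ℂ) :
    Integrable (fun z => 𝓕⁻ (⇑G) (A z)) ∧
    𝓕 (fun z => 𝓕⁻ (⇑G) (A z)) = fun ζ => ∫ u, G (Θ (ζ, u)) := by
  have hGi : Integrable (fun x => G (Θ x)) (volume.prod volume) :=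
    (hΘ.integrable_comp G.integrable.aestronglyMeasurable).2 G.integrable
  set H : E → ℂ := fun ζ => ∫ u, G (Θ (ζ, u)) with hH
  have hHi : Integrable H := hGi.integral_prod_left
  have hHc : Continuous H := by
    let m : ℕ := Module.finrank ℝ U + 1
    obtain ⟨C, hC⟩ : ∃ C : ℝ, ∀ x, (1 + ‖x‖) ^ m * ‖G x‖ ≤ C := by
      refine ⟨2 ^ m * (Finset.Iic (m, 0)).sup (fun m => SchwartzMap.seminorm ℝ m.1 m.2) G, fun x => ?_⟩
      have := SchwartzMap.one_add_le_sup_seminorm_apply (𝕜 := ℝ) (m := (m, 0)) (le_refl m) (le_refl 0) G x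
      simpa using this
    have hint : Integrable (fun u : U => C * (1 + ‖u‖) ^ (-(m : ℝ))) :=
      (integrable_one_add_norm (by simp [m])).const_mul C
    refine continuous_of_dominated (bound := fun u => C * (1 + ‖u‖) ^ (-(m : ℝ))) ?_ ?_ hint ?_
    · intro ζ
      exact (G.continuous.comp (hΘc.comp (by fun_prop))).aestronglyMeasurable
    · intro ζ
      refine Filter.Eventually.of_forall fun u => ?_
      rw [Real.rpow_neg (by positivity), Real.rpow_natCast, ← div_eq_mul_inv, le_div_iff₀ (by positivity), mul_comm]
      refine le_trans ?_ (hC (Θ (ζ, u)))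
      gcongr
      exact hn ζ u
    · refine Filter.Eventually.of_forall fun u => ?_
      exact G.continuous.comp (hΘc.comp (by fun_prop))
  have hinv : ∀ z, 𝓕⁻ H z = 𝓕⁻ (⇑G) (A z) := by
    intro z
    rw [Real.fourierInv_eq', Real.fourierInv_eq']
    have hcont : Continuous fun v => Complex.exp (↑(2 * Real.pi * inner ℝ v (A z)) * Complex.I) • G v := by
      have := G.continuous
      fun_prop
    rw [← hΘ.map_eq, integral_map hΘ.measurable.aemeasurable hcont.aestronglyMeasurable]
    simp only [hin, hH]
    rw [integral_prod]
    · refine integral_congr_ae (Filter.Eventually.of_forall fun ζ => ?_)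
      simp only
      rw [integral_smul]
    · simp only [smul_eq_mul]
      refine hGi.bdd_mul (c := 1) ?_ ?_
      · apply Continuous.aestronglyMeasurable
        fun_prop
      · refine Filter.Eventually.of_forall fun u => ?_
        rw [Complex.norm_exp_ofReal_mul_I]
  obtain ⟨K, -, hK⟩ := A.exists_antilipschitzWith (LinearMap.ker_eq_bot.2 hA)
  have hAt : Function.HasTemperateGrowth A := (LinearMap.toContinuousLinearMap A).hasTemperateGrowth
  let h : SchwartzMap E ℂ := SchwartzMap.compCLMOfAntilipschitz ℂ hAt hK (𝓕⁻ G)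
  have hh : ⇑h = fun z => 𝓕⁻ (⇑G) (A z) := by
    funext z
    simp only [h, SchwartzMap.compCLMOfAntilipschitz_apply, Function.comp, SchwartzMap.fourierInv_coe]
  have hhi : Integrable (fun z => 𝓕⁻ (⇑G) (A z)) := by rw [← hh]; exact h.integrable
  refine ⟨hhi, ?_⟩
  have e1 : (fun z => 𝓕⁻ (⇑G) (A z)) = 𝓕⁻ H := by funext z; rw [hinv]
  rw [e1]
  apply Continuous.fourier_fourierInv_eq hHc hHi
  have e2 : 𝓕 H = fun z => 𝓕⁻ H (-z) := by
    funext z; rw [Real.fourierInv_eq_fourier_neg, neg_neg]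
  rw [e2, ← e1]
  exact hhi.comp_neg
abbrev V2 := Fin 2 → ℝ

def slotOf {n : ℕ} (ζ : PairSpace 2 n) (s : Fin n ⊕ Fin n) : V2 :=
  Sum.elim (fun l i => ζ (Sum.inl (l, i))) (fun l i => ζ (Sum.inr (l, i))) s

noncomputable def ofSlots {n : ℕ} (X : Fin n ⊕ Fin n → V2) : PairSpace 2 n :=
  WithLp.toLp 2 (Sum.elim (fun q => X (Sum.inl q.1) q.2) (fun q => X (Sum.inr q.1) q.2))

lemma slotOf_ofSlots {n : ℕ} (X : Fin n ⊕ Fin n → V2) : slotOf (ofSlots X) = X := by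
  funext s i; cases s <;> rfl

lemma ofSlots_slotOf {n : ℕ} (ζ : PairSpace 2 n) : ofSlots (slotOf ζ) = ζ := by
  ext q; rcases q with ⟨l, i⟩ | ⟨l, i⟩ <;> rfl

def combine {k p : ℕ} (X : Fin k ⊕ Fin k → V2) (U : Fin p ⊕ Fin p → V2) : Fin (k + p) ⊕ Fin (k + p) → V2 :=
  Sum.elim (Fin.append (fun l => X (Sum.inl l)) (fun l => U (Sum.inl l)))
    (Fin.append (fun l => X (Sum.inr l)) (fun l => U (Sum.inr l)))

/-- inclusion of old / new slots -/
def oldS {k p : ℕ} : Fin k ⊕ Fin k → Fin (k + p) ⊕ Fin (k + p) := Sum.map (Fin.castAdd p) (Fin.castAdd p)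
def newS {k p : ℕ} : Fin p ⊕ Fin p → Fin (k + p) ⊕ Fin (k + p) := Sum.map (Fin.natAdd k) (Fin.natAdd k)

lemma combine_old {k p : ℕ} (X : Fin k ⊕ Fin k → V2) (U : Fin p ⊕ Fin p → V2) (s) :
    combine X U (oldS s) = X s := by
  cases s <;> simp [combine, oldS]

lemma combine_new {k p : ℕ} (X : Fin k ⊕ Fin k → V2) (U : Fin p ⊕ Fin p → V2) (s) :
    combine X U (newS s) = U s := by
  cases s <;> simp [combine, newS]

lemma sum_slots {M : Type*} [AddCommMonoid M] {k p : ℕ} (f : Fin (k + p) ⊕ Fin (k + p) → M) :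
    ∑ s, f s = ∑ s : Fin k ⊕ Fin k, f (oldS s) + ∑ s : Fin p ⊕ Fin p, f (newS s) := by
  simp only [Fintype.sum_sum_type, Fin.sum_univ_add, oldS, newS, Sum.map_inl, Sum.map_inr]
  abel

lemma prod_slots {M : Type*} [CommMonoid M] {k p : ℕ} (f : Fin (k + p) ⊕ Fin (k + p) → M) :
    ∏ s, f s = (∏ s : Fin k ⊕ Fin k, f (oldS s)) * ∏ s : Fin p ⊕ Fin p, f (newS s) := by
  simp only [Fintype.prod_sum_type, Fin.prod_univ_add, oldS, newS, Sum.map_inl, Sum.map_inr]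
  ac_rfl

lemma prod_upd {M ι : Type*} [CommMonoid M] [Fintype ι] [DecidableEq ι] {V : Type*} (f : ι → V → M) (x : ι → V) (J : ι) (v : V) :
    ∏ s, f s (Function.update x J v s) = f J v * ∏ s ∈ Finset.univ.erase J, f s (x s) := by
  rw [← Finset.mul_prod_erase _ _ (Finset.mem_univ J), Function.update_self]
  congr 1
  refine Finset.prod_congr rfl fun s hs => ?_
  rw [Function.update_of_ne (Finset.ne_of_mem_erase hs)]

lemma sum_upd {M ι : Type*} [AddCommMonoid M] [Fintype ι] [DecidableEq ι] {V : Type*} (f : ι → V → M) (x : ι → V) (J : ι) (v : V) :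
    ∑ s, f s (Function.update x J v s) = f J v + ∑ s ∈ Finset.univ.erase J, f s (x s) := by
  rw [← Finset.add_sum_erase _ _ (Finset.mem_univ J), Function.update_self]
  congr 1
  refine Finset.sum_congr rfl fun s hs => ?_
  rw [Function.update_of_ne (Finset.ne_of_mem_erase hs)]

lemma inner_ofSlots {n : ℕ} (X Y : Fin n ⊕ Fin n → V2) :
    inner ℝ (ofSlots X) (ofSlots Y) = ∑ s, ∑ i, X s i * Y s i := by
  rw [PiLp.inner_apply]
  simp only [Fintype.sum_sum_type, Fintype.sum_prod_type]
  simp [ofSlots, mul_comm]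

lemma continuous_ofSlots {n : ℕ} : Continuous (ofSlots (n := n)) := by
  unfold ofSlots
  refine (PiLp.continuous_toLp 2 _).comp ?_
  refine continuous_pi fun q => ?_
  rcases q with ⟨l, i⟩ | ⟨l, i⟩ <;> simp only [Sum.elim_inl, Sum.elim_inr] <;> fun_prop

lemma continuous_slotOf {n : ℕ} : Continuous (slotOf (n := n)) := by
  unfold slotOf
  refine continuous_pi fun s => ?_
  rcases s with l | l <;> simp only [Sum.elim_inl, Sum.elim_inr] <;> fun_prop

lemma continuous_combine {k p : ℕ} : Continuous fun x : (Fin k ⊕ Fin k → V2) × (Fin p ⊕ Fin p → V2) => combine x.1 x.2 := by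
  refine continuous_pi fun s => ?_
  rcases s with l | l <;> simp only [combine, Sum.elim_inl, Sum.elim_inr] <;>
    induction l using Fin.addCases <;> simp only [Fin.append_left, Fin.append_right] <;> fun_prop

lemma ofSlots_mp {n : ℕ} : MeasurePreserving (ofSlots (n := n)) volume volume := by
  have h : MeasurePreserving (fun X : Fin n ⊕ Fin n → V2 =>
      (Sum.elim (fun q : Fin n × Fin 2 => X (Sum.inl q.1) q.2) (fun q => X (Sum.inr q.1) q.2) : (Fin n × Fin 2) ⊕ (Fin n × Fin 2) → ℝ))
      volume volume := by
    have hm : Measurable (fun X : Fin n ⊕ Fin n → V2 =>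
      (Sum.elim (fun q : Fin n × Fin 2 => X (Sum.inl q.1) q.2) (fun q => X (Sum.inr q.1) q.2) : (Fin n × Fin 2) ⊕ (Fin n × Fin 2) → ℝ)) := by
      refine measurable_pi_iff.2 fun q => ?_
      rcases q with ⟨l, i⟩ | ⟨l, i⟩ <;> simp only [Sum.elim_inl, Sum.elim_inr] <;> fun_prop
    refine ⟨hm, ?_⟩
    symm
    refine Measure.pi_eq fun S hS => ?_
    rw [Measure.map_apply hm (MeasurableSet.univ_pi hS)]
    have : (fun X : Fin n ⊕ Fin n → V2 =>
      (Sum.elim (fun q : Fin n × Fin 2 => X (Sum.inl q.1) q.2) (fun q => X (Sum.inr q.1) q.2) : (Fin n × Fin 2) ⊕ (Fin n × Fin 2) → ℝ)) ⁻¹' (Set.univ.pi S)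
       = Set.univ.pi fun s => Set.univ.pi fun i => S (Sum.elim (fun l => Sum.inl (l, i)) (fun l => Sum.inr (l, i)) s) := by
      ext X
      simp [Set.mem_pi]
    rw [this, volume_pi_pi]
    simp only [volume_pi_pi, Fintype.prod_sum_type, Fintype.prod_prod_type, Sum.elim_inl, Sum.elim_inr]
  exact (PiLp.volume_preserving_toLp _).comp h

lemma slotOf_mp {n : ℕ} : MeasurePreserving (slotOf (n := n)) volume volume := by
  refine ⟨continuous_slotOf.measurable, ?_⟩
  rw [← (ofSlots_mp (n := n)).map_eq, Measure.map_map continuous_slotOf.measurable ofSlots_mp.measurable]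
  have : slotOf (n := n) ∘ ofSlots = id := funext slotOf_ofSlots
  rw [this, Measure.map_id]

lemma combine_mp {k p : ℕ} : MeasurePreserving (fun x : (Fin k ⊕ Fin k → V2) × (Fin p ⊕ Fin p → V2) => combine x.1 x.2)
    (volume.prod volume) volume := by
  have hm := (continuous_combine (k := k) (p := p)).measurable
  refine ⟨hm, ?_⟩
  symm
  refine Measure.pi_eq fun S hS => ?_
  rw [Measure.map_apply hm (MeasurableSet.univ_pi hS)]
  have : (fun x : (Fin k ⊕ Fin k → V2) × (Fin p ⊕ Fin p → V2) => combine x.1 x.2) ⁻¹' (Set.univ.pi S)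
       = (Set.univ.pi fun s => S (oldS s)) ×ˢ (Set.univ.pi fun s => S (newS s)) := by
    ext x
    simp only [Set.mem_preimage, Set.mem_pi, Set.mem_univ, forall_true_left, Set.mem_prod]
    constructor
    · intro h
      refine ⟨fun s => ?_, fun s => ?_⟩
      · have := h (oldS s); rwa [combine_old] at this
      · have := h (newS s); rwa [combine_new] at this
    · rintro ⟨h1, h2⟩ s
      rcases s with l | l <;> induction l using Fin.addCases with
      | left l => first | simpa [combine, oldS] using h1 (Sum.inl l) | simpa [combine, oldS] using h1 (Sum.inr l)
      | right l => first | simpa [combine, newS] using h2 (Sum.inl l) | simpa [combine, newS] using h2 (Sum.inr l)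
  rw [this, Measure.prod_prod, volume_pi_pi, volume_pi_pi, prod_slots]

noncomputable def ThetaMap {k p N : ℕ} (e : Fin p ⊕ Fin p ≃ Fin (N + 2)) (J : Fin k ⊕ Fin k)
    (x : PairSpace 2 k × (Fin (N + 2) → V2)) : PairSpace 2 (k + p) :=
  ofSlots (combine (Function.update (slotOf x.1) J (slotOf x.1 J - ∑ a, x.2 a)) (fun s => x.2 (e s)))

lemma continuous_ThetaMap {k p N : ℕ} (e : Fin p ⊕ Fin p ≃ Fin (N + 2)) (J : Fin k ⊕ Fin k) :
    Continuous (ThetaMap e J) := by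
  unfold ThetaMap
  refine continuous_ofSlots.comp (continuous_combine.comp (f := fun x : PairSpace 2 k × (Fin (N + 2) → V2) =>
    (Function.update (slotOf x.1) J (slotOf x.1 J - ∑ a, x.2 a), fun s => x.2 (e s))) (Continuous.prodMk ?_ ?_))
  · have := continuous_slotOf (n := k)
    refine Continuous.update (by fun_prop) J ?_
    have h2 : Continuous fun x : PairSpace 2 k × (Fin (N + 2) → V2) => slotOf x.1 J :=
      (continuous_apply J).comp (this.comp continuous_fst)
    fun_prop
  · fun_prop

lemma ThetaMap_mp {k p N : ℕ} (e : Fin p ⊕ Fin p ≃ Fin (N + 2)) (J : Fin k ⊕ Fin k) :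
    MeasurePreserving (ThetaMap e J) (volume.prod volume) volume := by
  have h1 : MeasurePreserving (Prod.map (slotOf (n := k)) (id : (Fin (N + 2) → V2) → _)) (volume.prod volume) (volume.prod volume) :=
    slotOf_mp.prod (MeasurePreserving.id _)
  have h2 : MeasurePreserving (fun x : (Fin (N + 2) → V2) × (Fin k ⊕ Fin k → V2) =>
      (x.1, x.2 - Pi.single J (∑ a, x.1 a))) (volume.prod volume) (volume.prod volume) := by
    refine MeasurePreserving.skew_product (μa := volume) (μb := volume) (μc := volume) (μd := volume)
      (g := fun (v : Fin (N + 2) → V2) (x : Fin k ⊕ Fin k → V2) => x - Pi.single J (∑ a, v a))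
      (MeasurePreserving.id _) ?_ ?_
    · have hs : Measurable (fun w : V2 => (Pi.single J w : Fin k ⊕ Fin k → V2)) :=
        (continuous_single J).measurable
      have : Measurable fun x : (Fin (N + 2) → V2) × (Fin k ⊕ Fin k → V2) => (Pi.single J (∑ a, x.1 a) : Fin k ⊕ Fin k → V2) :=
        hs.comp (by fun_prop)
      exact measurable_snd.sub this
    · refine Filter.Eventually.of_forall fun v => ?_
      exact (measurePreserving_sub_right volume _).map_eq
  have h3 : MeasurePreserving (Prod.swap : (Fin k ⊕ Fin k → V2) × (Fin (N + 2) → V2) → _) (volume.prod volume) (volume.prod volume) :=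
    Measure.measurePreserving_swap
  have h3' : MeasurePreserving (Prod.swap : (Fin (N + 2) → V2) × (Fin k ⊕ Fin k → V2) → _) (volume.prod volume) (volume.prod volume) :=
    Measure.measurePreserving_swap
  have h4 : MeasurePreserving (fun (u : Fin (N + 2) → V2) (s : Fin p ⊕ Fin p) => u (e s)) volume volume :=
    (volume_measurePreserving_piCongrLeft (fun _ : Fin (N + 2) => V2) e).symm
  have h5 : MeasurePreserving (Prod.map (id : (Fin k ⊕ Fin k → V2) → _) (fun (u : Fin (N + 2) → V2) (s : Fin p ⊕ Fin p) => u (e s)))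
      (volume.prod volume) (volume.prod volume) :=
    (MeasurePreserving.id _).prod h4
  have h := ofSlots_mp.comp (combine_mp.comp (h5.comp (h3'.comp (h2.comp (h3.comp h1)))))
  refine (congrArg (fun F => MeasurePreserving F (volume.prod volume) volume) ?_).mpr h
  funext x
  simp only [ThetaMap, Function.comp, Prod.map, Prod.swap, id]
  congr 2
  funext s
  by_cases hs : s = J
  · subst hs; simp
  · simp [hs]

noncomputable def AMap {k p : ℕ} (J : Fin k ⊕ Fin k) : PairSpace 2 k →ₗ[ℝ] PairSpace 2 (k + p) where
  toFun z := ofSlots (combine (slotOf z) (fun _ => slotOf z J))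
  map_add' x y := by
    ext q
    rcases q with ⟨l, i⟩ | ⟨l, i⟩ <;> induction l using Fin.addCases <;> rcases J with J | J <;> simp [ofSlots, combine, slotOf]
  map_smul' c x := by
    ext q
    rcases q with ⟨l, i⟩ | ⟨l, i⟩ <;> induction l using Fin.addCases <;> rcases J with J | J <;> simp [ofSlots, combine, slotOf]

lemma AMap_apply {k p : ℕ} (J : Fin k ⊕ Fin k) (z) :
  AMap (p := p) J z = ofSlots (combine (slotOf z) (fun _ => slotOf z J)) := rfl

lemma AMap_inj {k p : ℕ} (J : Fin k ⊕ Fin k) : Function.Injective (AMap (p := p) J) := by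
  intro x y h
  rw [AMap_apply, AMap_apply] at h
  have h2 := congrArg slotOf h
  rw [slotOf_ofSlots, slotOf_ofSlots] at h2
  have h3 : slotOf x = slotOf y := by
    funext s
    have := congrFun h2 (oldS s)
    rwa [combine_old, combine_old] at this
  rw [← ofSlots_slotOf x, h3, ofSlots_slotOf]

lemma inner_Theta_A {k p N : ℕ} (e : Fin p ⊕ Fin p ≃ Fin (N + 2)) (J : Fin k ⊕ Fin k) (z ζ : PairSpace 2 k) (u : Fin (N + 2) → V2) :
    inner ℝ (ThetaMap e J (ζ, u)) (AMap (p := p) J z) = inner ℝ ζ z := by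
  conv_rhs => rw [← ofSlots_slotOf ζ, ← ofSlots_slotOf z, inner_ofSlots, ← Finset.add_sum_erase _ _ (Finset.mem_univ J)]
  rw [AMap_apply, ThetaMap, inner_ofSlots, sum_slots]
  simp only [combine_old, combine_new]
  rw [sum_upd (fun s (v : V2) => ∑ i, v i * slotOf z s i), e.sum_comp (fun a => ∑ i, u a i * slotOf z J i)]
  rw [Finset.sum_comm (s := Finset.univ (α := Fin (N + 2)))]
  simp only [Pi.sub_apply, Finset.sum_apply, sub_mul, Finset.sum_sub_distrib, Finset.sum_mul]
  ring

lemma norm_Theta {k p N : ℕ} (e : Fin p ⊕ Fin p ≃ Fin (N + 2)) (J : Fin k ⊕ Fin k) (ζ : PairSpace 2 k) (u : Fin (N + 2) → V2) :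
    ‖u‖ ≤ ‖ThetaMap e J (ζ, u)‖ := by
  refine (pi_norm_le_iff_of_nonneg (norm_nonneg _)).2 fun a => (pi_norm_le_iff_of_nonneg (norm_nonneg _)).2 fun i => ?_
  obtain ⟨s, rfl⟩ := e.surjective a
  have h : u (e s) i = slotOf (ThetaMap e J (ζ, u)) (newS s) i := by
    rw [ThetaMap, slotOf_ofSlots, combine_new]
  rw [h]
  rcases s with l | l
  · exact PiLp.norm_apply_le (ThetaMap e J (ζ, u)) (Sum.inl (Fin.natAdd k l, i))
  · exact PiLp.norm_apply_le (ThetaMap e J (ζ, u)) (Sum.inr (Fin.natAdd k l, i))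

def sg {n : ℕ} (s : Fin n ⊕ Fin n) : ℝ := Sum.elim (fun _ => 1) (fun _ => -1) s

lemma phase_slots {n : ℕ} (ζ : PairSpace 2 n) :
    normSqUnprimed 2 n ζ - normSqPrimed 2 n ζ = ∑ s, sg s * sq2 (slotOf ζ s) := by
  simp only [normSqUnprimed, normSqPrimed, Fintype.sum_sum_type, Fintype.sum_prod_type, sg, slotOf, Sum.elim_inl, Sum.elim_inr, sq2]
  simp [sub_eq_add_neg, ← Finset.sum_neg_distrib, add_comm]

lemma weight_slots {n : ℕ} (α : ℝ) (ζ : PairSpace 2 n) :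
    ‖(weightS 2 n α ζ : ℂ)‖ₑ ^ 2 = ∏ s, brw α (slotOf ζ s) := by
  have hp : ∀ x : V2, 0 < 1 + sq2 x := fun x => by have := sq2_nonneg x; linarith
  have h1 : weightS 2 n α ζ = ∏ s : Fin n ⊕ Fin n, (1 + sq2 (slotOf ζ s)) ^ (α / 2) := by
    simp only [weightS, Fintype.prod_sum_type, Finset.prod_mul_distrib, slotOf, Sum.elim_inl, Sum.elim_inr, sq2]
  rw [h1, ← ofReal_norm, Complex.norm_real, Real.norm_of_nonneg (Finset.prod_nonneg fun s _ => Real.rpow_nonneg (hp _).le _),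
    ENNReal.ofReal_prod_of_nonneg (fun s _ => Real.rpow_nonneg (hp _).le _), ← Finset.prod_pow]
  refine Finset.prod_congr rfl fun s _ => ?_
  rw [brw, ← ENNReal.ofReal_pow (Real.rpow_nonneg (hp _).le _), ← Real.rpow_natCast, ← Real.rpow_mul (hp _).le]
  congr 2
  push_cast; ring

lemma contractB_eq {k p : ℕ} (j : Fin k) (γ : PairSpace 2 (k + p) → ℂ) (z : PairSpace 2 k) :
    contractB 2 k p j γ z = γ (AMap (Sum.inl j) z) - γ (AMap (Sum.inr j) z) := by
  have key : ∀ J : Fin k ⊕ Fin k, ∀ y : V2, y = slotOf z J → 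
    toEuc _ (Sum.elim (fun q : Fin (k + p) × Fin 2 => if h : (q.1 : ℕ) < k then z (Sum.inl (⟨q.1, h⟩, q.2)) else y q.2)
       (fun q : Fin (k + p) × Fin 2 => if h : (q.1 : ℕ) < k then z (Sum.inr (⟨q.1, h⟩, q.2)) else y q.2)) = AMap (p := p) J z := by
    rintro J y rfl
    rw [AMap_apply]
    ext q
    rcases q with ⟨l, i⟩ | ⟨l, i⟩ <;> induction l using Fin.addCases <;> simp [ofSlots, combine, slotOf, toEuc]
  rw [← key (Sum.inl j) _ rfl, ← key (Sum.inr j) _ rfl]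
  rfl

lemma fourier_sub_aux {E : Type*} [NormedAddCommGroup E] [InnerProductSpace ℝ E] [FiniteDimensional ℝ E]
    [MeasurableSpace E] [BorelSpace E] (f g : E → ℂ) (hf : Integrable f) (hg : Integrable g) (w : E) :
    𝓕 (fun z => f z - g z) w = 𝓕 f w - 𝓕 g w := by
  have key : ∀ h : E → ℂ, Integrable h → Integrable fun v : E => Complex.exp (↑(-2 * Real.pi * inner ℝ v w) * Complex.I) • h v := by
    intro h hh
    simp only [smul_eq_mul]
    refine hh.bdd_mul (c := 1) (by apply Continuous.aestronglyMeasurable; fun_prop) ?_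
    refine Filter.Eventually.of_forall fun u => ?_
    rw [Complex.norm_exp_ofReal_mul_I]
  rw [Real.fourier_eq', Real.fourier_eq', Real.fourier_eq', ← integral_sub (key f hf) (key g hg)]
  simp only [smul_sub]

lemma eLpNorm_two_sq {X : Type*} [MeasurableSpace X] (μ : Measure X) (f : X → ℂ) :
    eLpNorm f 2 μ ^ 2 = ∫⁻ x, ‖f x‖ₑ ^ 2 ∂μ := by
  have h := eLpNorm_nnreal_pow_eq_lintegral (f := f) (μ := μ) (p := 2) (by norm_num)
  simpa using h

/-- phase function -/
noncomputable def phs {n : ℕ} (w : PairSpace 2 n) : ℝ := normSqUnprimed 2 n w - normSqPrimed 2 n w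

lemma continuous_phs {n : ℕ} : Continuous (phs (n := n)) := by
  unfold phs normSqUnprimed normSqPrimed; fun_prop

noncomputable def HJ {k p N : ℕ} (e : Fin p ⊕ Fin p ≃ Fin (N + 2)) (J : Fin k ⊕ Fin k) (F : PairSpace 2 (k + p) → ℂ)
    (q : ℝ × PairSpace 2 k) : ℂ :=
  ∫ u, Complex.exp (-Complex.I * q.1 * (phs (ThetaMap e J (q.2, u)) : ℂ)) * F (ThetaMap e J (q.2, u))

lemma measurable_HJ {k p N : ℕ} (e : Fin p ⊕ Fin p ≃ Fin (N + 2)) (J : Fin k ⊕ Fin k) (F : PairSpace 2 (k + p) → ℂ)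
    (hF : Continuous F) : Measurable (HJ e J F) := by
  have h : Continuous fun x : (ℝ × PairSpace 2 k) × (Fin (N + 2) → V2) =>
    Complex.exp (-Complex.I * x.1.1 * (phs (ThetaMap e J (x.1.2, x.2)) : ℂ)) * F (ThetaMap e J (x.1.2, x.2)) := by
    have h1 := continuous_ThetaMap e J
    have h2 := continuous_phs (n := k + p)
    fun_prop
  exact h.stronglyMeasurable.integral_prod_right'.measurable

lemma Theta_phase {k p N : ℕ} (e : Fin p ⊕ Fin p ≃ Fin (N + 2)) (J : Fin k ⊕ Fin k) (ζ : PairSpace 2 k) (u : Fin (N + 2) → V2) :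
    phs (ThetaMap e J (ζ, u)) = (∑ s ∈ Finset.univ.erase J, sg s * sq2 (slotOf ζ s)) +
      (sg J * sq2 (slotOf ζ J - ∑ a, u a) + ∑ a, sg (e.symm a) * sq2 (u a)) := by
  rw [phs, phase_slots, ThetaMap, slotOf_ofSlots, sum_slots]
  simp only [combine_old, combine_new]
  have hs : ∀ s : Fin k ⊕ Fin k, sg (oldS (p := p) s) = sg s := by intro s; cases s <;> rfl
  have hs' : ∀ s : Fin p ⊕ Fin p, sg (newS (k := k) s) = sg s := by intro s; cases s <;> rfl
  simp only [hs, hs']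
  rw [sum_upd (fun s v => sg s * sq2 v), ← e.sum_comp (fun a => sg (e.symm a) * sq2 (u a))]
  simp only [Equiv.symm_apply_apply]
  ring

lemma Theta_weight {k p N : ℕ} (α : ℝ) (e : Fin p ⊕ Fin p ≃ Fin (N + 2)) (J : Fin k ⊕ Fin k) (ζ : PairSpace 2 k) (u : Fin (N + 2) → V2) :
    ∏ s, brw α (slotOf (ThetaMap e J (ζ, u)) s) = (∏ s ∈ Finset.univ.erase J, brw α (slotOf ζ s)) *
      (brw α (slotOf ζ J - ∑ a, u a) * ∏ a, brw α (u a)) := by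
  rw [ThetaMap, slotOf_ofSlots, prod_slots]
  simp only [combine_old, combine_new]
  rw [prod_upd (fun s v => brw α v), ← e.prod_comp (fun a => brw α (u a))]
  ring

lemma measurable_wt {n : ℕ} (α : ℝ) : Measurable fun ζ : PairSpace 2 n => ∏ s, brw α (slotOf ζ s) := by
  refine Finset.measurable_prod _ fun s _ => ?_
  exact (measurable_brw α).comp ((measurable_pi_apply s).comp continuous_slotOf.measurable)

lemma oneJ (α : ℝ) (hα : 1 / 2 < α) (hα1 : α < 1) (m : ℕ) (hN : ((2 * m : ℕ) + 1) * (1 - α) < 1 / 2) :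
    ∃ K : ℝ≥0∞, K ≠ ⊤ ∧ ∀ (k : ℕ) (e : Fin (m + 1) ⊕ Fin (m + 1) ≃ Fin (2 * m + 2)) (J : Fin k ⊕ Fin k)
      (F : PairSpace 2 (k + (m + 1)) → ℂ), Continuous F → Integrable F →
      ∫⁻ q : ℝ × PairSpace 2 k, (∏ s, brw α (slotOf q.2 s)) * ‖HJ e J F q‖ₑ ^ 2 ≤
        K * ∫⁻ w, (∏ s, brw α (slotOf w s)) * ‖F w‖ₑ ^ 2 := by
  obtain ⟨K, hK, h⟩ := core3 α hα hα1 (2 * m) hN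
  refine ⟨K, hK, ?_⟩
  intro k e J F hFc hFi
  have mp := ThetaMap_mp e J
  have hΘc := continuous_ThetaMap e J
  have hFm := hFc.measurable
  have hHm := measurable_HJ e J F hFc
  have hwm := measurable_wt (n := k) α
  have hwm2 := measurable_wt (n := k + (m + 1)) α
  have hint : Integrable (fun x => F (ThetaMap e J x)) (volume.prod volume) :=
    (mp.integrable_comp hFi.aestronglyMeasurable).2 hFi
  have hM1 : Measurable fun q : ℝ × PairSpace 2 k => (∏ s, brw α (slotOf q.2 s)) * ‖HJ e J F q‖ₑ ^ 2 :=
    (hwm.comp measurable_snd).mul (hHm.enorm.pow_const 2)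
  have hM2 : Measurable fun w : PairSpace 2 (k + (m + 1)) => (∏ s, brw α (slotOf w s)) * ‖F w‖ₑ ^ 2 :=
    hwm2.mul (hFm.enorm.pow_const 2)
  have hbt : ∀ x, brw α x ≠ ⊤ := fun x => by simp [brw]
  rw [Measure.volume_eq_prod, lintegral_prod_symm' _ hM1,
    ← mp.lintegral_comp (f := fun w => (∏ s, brw α (slotOf w s)) * ‖F w‖ₑ ^ 2) hM2,
    lintegral_prod _ (by
      have := mp.measurable
      have : Measurable fun x => (∏ s, brw α (slotOf (ThetaMap e J x) s)) * ‖F (ThetaMap e J x)‖ₑ ^ 2 :=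
        hM2.comp this
      exact this.aemeasurable),
    ← lintegral_const_mul' K _ hK]
  refine lintegral_mono_ae ?_
  filter_upwards [hint.prod_right_ae] with ζ hζ
  rw [lintegral_const_mul' _ _ (ENNReal.prod_ne_top fun s _ => hbt _)]
  simp only [Theta_weight]
  have hb : ∃ b, sg (e.symm b) = - sg J := by
    rcases J with J | J
    · exact ⟨e (Sum.inr 0), by simp [sg]⟩
    · exact ⟨e (Sum.inl 0), by simp [sg]⟩
  obtain ⟨b, hb⟩ := hb
  have habs : ∀ n, ∀ s : Fin n ⊕ Fin n, |sg s| = 1 := by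
    intro n s; rcases s with s | s <;> simp [sg]
  have key := h (slotOf ζ J) b (sg J) (fun a => sg (e.symm a)) (fun u => F (ThetaMap e J (ζ, u)))
    (habs _ _) (fun j => habs _ _) hb (hFm.comp (hΘc.measurable.comp (by fun_prop))) hζ
  set c : ℝ := ∑ s ∈ Finset.univ.erase J, sg s * sq2 (slotOf ζ s) with hc
  have hHn : ∀ t : ℝ, ‖HJ e J F (t, ζ)‖ₑ = ‖∫ u : Fin (2 * m + 2) → Fin 2 → ℝ, Complex.exp (-Complex.I * t *
        ((sg J * sq2 (slotOf ζ J - ∑ j, u j) + ∑ j, sg (e.symm j) * sq2 (u j) : ℝ) : ℂ)) * F (ThetaMap e J (ζ, u))‖ₑ := by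
    intro t
    have : HJ e J F (t, ζ) = Complex.exp (((-(t * c) : ℝ) : ℂ) * Complex.I) * ∫ u : Fin (2 * m + 2) → Fin 2 → ℝ, Complex.exp (-Complex.I * t *
        ((sg J * sq2 (slotOf ζ J - ∑ j, u j) + ∑ j, sg (e.symm j) * sq2 (u j) : ℝ) : ℂ)) * F (ThetaMap e J (ζ, u)) := by
      rw [HJ, ← integral_const_mul]
      refine integral_congr_ae (Filter.Eventually.of_forall fun u => ?_)
      simp only
      rw [← mul_assoc, ← Complex.exp_add, Theta_phase, ← hc]
      congr 2
      push_cast; ring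
    rw [this, enorm_mul]
    have : ‖Complex.exp (((-(t * c) : ℝ) : ℂ) * Complex.I)‖ₑ = 1 := by
      rw [← ofReal_norm, Complex.norm_exp_ofReal_mul_I]; simp
    rw [this, one_mul]
  simp only [hHn]
  rw [← Finset.mul_prod_erase _ _ (Finset.mem_univ J), mul_comm (brw α _), mul_assoc]
  refine (mul_le_mul_right key _).trans (le_of_eq ?_)
  rw [mul_left_comm, ← lintegral_const_mul' (∏ s ∈ Finset.univ.erase J, brw α (slotOf ζ s)) _ (ENNReal.prod_ne_top fun s _ => hbt _)]
  congr 1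
  refine lintegral_congr fun u => ?_
  ring

lemma phase_temperate {n : ℕ} (t : ℝ) : Function.HasTemperateGrowth (fun ζ : PairSpace 2 n =>
    Complex.exp (-Complex.I * t * ((normSqUnprimed 2 n ζ : ℂ) - (normSqPrimed 2 n ζ : ℂ)))) := by
  have hc : ∀ q, Function.HasTemperateGrowth (fun ζ : PairSpace 2 n => ζ q) := fun q =>
    (EuclideanSpace.proj (𝕜 := ℝ) q : PairSpace 2 n →L[ℝ] ℝ).hasTemperateGrowth
  have h : Function.HasTemperateGrowth (fun ζ : PairSpace 2 n => -t * (normSqUnprimed 2 n ζ - normSqPrimed 2 n ζ)) := by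
    refine Function.HasTemperateGrowth.mul (Function.HasTemperateGrowth.const _) (Function.HasTemperateGrowth.sub ?_ ?_)
    · unfold normSqUnprimed
      refine Function.HasTemperateGrowth.sum fun q _ => (hc _).pow 2
    · unfold normSqPrimed
      refine Function.HasTemperateGrowth.sum fun q _ => (hc _).pow 2
  have h2 := expI_temperate.comp h
  refine (congrArg Function.HasTemperateGrowth ?_).mpr h2
  funext ζ
  simp only [Function.comp]
  congr 1; push_cast; ring

lemma fourier_contract {k p N : ℕ} (e : Fin p ⊕ Fin p ≃ Fin (N + 2)) (j : Fin k) (γ₀ : SchwartzMap (PairSpace 2 (k + p)) ℂ)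
    (t : ℝ) (ζ : PairSpace 2 k) :
    𝓕 (contractB 2 k p j (freeEvolution 2 (k + p) (⇑γ₀) t)) ζ =
      HJ e (Sum.inl j) (𝓕 (⇑γ₀)) (t, ζ) - HJ e (Sum.inr j) (𝓕 (⇑γ₀)) (t, ζ) := by
  have hT := phase_temperate (n := k + p) t
  let G : SchwartzMap (PairSpace 2 (k + p)) ℂ := SchwartzMap.smulLeftCLM ℂ (fun ζ : PairSpace 2 (k + p) =>
    Complex.exp (-Complex.I * t * ((normSqUnprimed 2 (k + p) ζ : ℂ) - (normSqPrimed 2 (k + p) ζ : ℂ)))) (𝓕 γ₀)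
  have hG : ⇑G = fun ζ : PairSpace 2 (k + p) => Complex.exp (-Complex.I * t * ((normSqUnprimed 2 (k + p) ζ : ℂ) - (normSqPrimed 2 (k + p) ζ : ℂ))) *
      𝓕 (⇑γ₀) ζ := by
    funext w
    simp only [G]
    rw [SchwartzMap.smulLeftCLM_apply_apply hT, SchwartzMap.fourier_coe, smul_eq_mul]
  have hfe : freeEvolution 2 (k + p) (⇑γ₀) t = 𝓕⁻ (⇑G) := by
    funext z; rw [freeEvolution, hG]
  have hr : ∀ J : Fin k ⊕ Fin k, _ := fun J => restrict_fourier (ThetaMap e J) (continuous_ThetaMap e J) (ThetaMap_mp e J)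
    (AMap J) (AMap_inj J) (inner_Theta_A e J) (norm_Theta e J) G
  have hc : contractB 2 k p j (freeEvolution 2 (k + p) (⇑γ₀) t) =
      fun z => 𝓕⁻ (⇑G) (AMap (Sum.inl j) z) - 𝓕⁻ (⇑G) (AMap (Sum.inr j) z) := by
    funext z; rw [contractB_eq, hfe]
  have hH : ∀ J : Fin k ⊕ Fin k, ∫ u, G (ThetaMap e J (ζ, u)) = HJ e J (𝓕 (⇑γ₀)) (t, ζ) := by
    intro J
    rw [HJ]
    refine integral_congr_ae (Filter.Eventually.of_forall fun u => ?_)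
    simp only [hG, phs, Complex.ofReal_sub]
  rw [hc, fourier_sub_aux _ _ (hr _).1 (hr _).1, (hr _).2, (hr _).2]
  simp only [hH]

lemma perP (p₀ : ℕ) (α : ℝ) (hαlow : 1 - 1 / (2 * (2 * (p₀ : ℝ) - 1)) < α) (hαhigh : α < 1) (p : ℕ) :
    ∃ K : ℝ≥0∞, K ≠ ⊤ ∧ (1 ≤ p → p ≤ p₀ → ∀ (k : ℕ) (j : Fin k) (γ₀ : SchwartzMap (PairSpace 2 (k + p)) ℂ),
      ∫⁻ q : ℝ × PairSpace 2 k, ‖(weightS 2 k α q.2 : ℂ) *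
                𝓕 (contractB 2 k p j (freeEvolution 2 (k + p) (⇑γ₀) q.1)) q.2‖ₑ ^ 2 ≤
      K * ∫⁻ ζ : PairSpace 2 (k + p), ‖(weightS 2 (k + p) α ζ : ℂ) * 𝓕 (⇑γ₀) ζ‖ₑ ^ 2) := by
  by_cases hp : 1 ≤ p ∧ p ≤ p₀
  swap
  · exact ⟨0, by simp, fun h1 h2 => absurd ⟨h1, h2⟩ hp⟩
  obtain ⟨hp1, hp2⟩ := hp
  obtain ⟨m, rfl⟩ : ∃ m, p = m + 1 := ⟨p - 1, by omega⟩
  have hm : (m : ℝ) + 1 ≤ p₀ := by exact_mod_cast hp2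
  have hm0 : (0 : ℝ) ≤ m := Nat.cast_nonneg m
  have hpos : 0 < 2 * (2 * (p₀ : ℝ) - 1) := by linarith
  have h1 : (1 - α) * (2 * (2 * (p₀ : ℝ) - 1)) < 1 := by
    have : 1 - α < 1 / (2 * (2 * (p₀ : ℝ) - 1)) := by linarith
    rwa [lt_div_iff₀ hpos] at this
  obtain ⟨K, hK, h⟩ := oneJ α (by nlinarith) hαhigh m (by push_cast; nlinarith)
  refine ⟨2 * (K + K), ENNReal.mul_ne_top (by simp) (by simp [hK]), fun _ _ k j γ₀ => ?_⟩
  let e : Fin (m + 1) ⊕ Fin (m + 1) ≃ Fin (2 * m + 2) := finSumFinEquiv.trans (finCongr (by omega))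
  have hFc : Continuous (𝓕 (⇑γ₀)) := by rw [← SchwartzMap.fourier_coe]; exact (𝓕 γ₀).continuous
  have hFi : Integrable (𝓕 (⇑γ₀)) := by rw [← SchwartzMap.fourier_coe]; exact (𝓕 γ₀).integrable
  have hA := h k e (Sum.inl j) (𝓕 (⇑γ₀)) hFc hFi
  have hB := h k e (Sum.inr j) (𝓕 (⇑γ₀)) hFc hFi
  simp only [fourier_contract e, enorm_mul, mul_pow, weight_slots]
  set T := ∫⁻ w : PairSpace 2 (k + (m + 1)), (∏ s, brw α (slotOf w s)) * ‖𝓕 (⇑γ₀) w‖ₑ ^ 2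
  have hm1 := measurable_HJ e (Sum.inl j) (𝓕 (⇑γ₀)) hFc
  have hwm := measurable_wt (n := k) α
  have hM1 : Measurable fun q : ℝ × PairSpace 2 k => (∏ s, brw α (slotOf q.2 s)) * ‖HJ e (Sum.inl j) (𝓕 (⇑γ₀)) q‖ₑ ^ 2 :=
    (hwm.comp measurable_snd).mul (hm1.enorm.pow_const 2)
  calc _ ≤ ∫⁻ q : ℝ × PairSpace 2 k, 2 * ((∏ s, brw α (slotOf q.2 s)) * ‖HJ e (Sum.inl j) (𝓕 (⇑γ₀)) q‖ₑ ^ 2 +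
        (∏ s, brw α (slotOf q.2 s)) * ‖HJ e (Sum.inr j) (𝓕 (⇑γ₀)) q‖ₑ ^ 2) := by
        refine lintegral_mono fun q => ?_
        have := enorm_sum_sq ![HJ e (Sum.inl j) (𝓕 (⇑γ₀)) q, - HJ e (Sum.inr j) (𝓕 (⇑γ₀)) q]
        simp only [Fin.sum_univ_two, Fintype.card_fin, Matrix.cons_val_zero, Matrix.cons_val_one, enorm_neg, ← sub_eq_add_neg] at this
        refine (mul_le_mul_right this _).trans (le_of_eq ?_)
        push_cast; ring
    _ = 2 * (_ + _) := by
        rw [lintegral_const_mul' _ _ (by simp), lintegral_add_left hM1]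
    _ ≤ 2 * (K * T + K * T) := by gcongr
    _ = _ := by ring

theorem free_evolution_strichartz_bound
    (p₀ : ℕ) (hp₀ : 1 ≤ p₀)
    (α : ℝ) (hαlow : 1 - 1 / (2 * (2 * (p₀ : ℝ) - 1)) < α) (hαhigh : α < 1) :
    ∃ C : ℝ, 0 < C ∧
      ∀ (p : ℕ), 1 ≤ p → p ≤ p₀ → ∀ (k : ℕ), 1 ≤ k → ∀ (j : Fin k),
        ∀ γ₀ : SchwartzMap (PairSpace 2 (k + p)) ℂ,
          eLpNorm
            (fun q : ℝ × PairSpace 2 k =>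
              (weightS 2 k α q.2 : ℂ) *
                𝓕 (contractB 2 k p j (freeEvolution 2 (k + p) (⇑γ₀) q.1)) q.2) 2 volume ≤
          ENNReal.ofReal C *
            eLpNorm
              (fun ζ : PairSpace 2 (k + p) =>
                (weightS 2 (k + p) α ζ : ℂ) * 𝓕 (⇑γ₀) ζ) 2 volume := by
  choose K hK hb using perP p₀ α hαlow hαhigh
  set S : ℝ≥0∞ := ∑ p ∈ Finset.range (p₀ + 1), K p with hS
  have hSt : S ≠ ⊤ := ENNReal.sum_ne_top.2 fun p _ => hK p
  refine ⟨S.toReal + 1, by positivity, ?_⟩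
  intro p hp1 hp2 k hk j γ₀
  rw [← ENNReal.pow_le_pow_left_iff two_ne_zero, mul_pow, eLpNorm_two_sq, eLpNorm_two_sq]
  refine (hb p hp1 hp2 k j γ₀).trans ?_
  refine mul_le_mul_left ?_ _
  have h1 : K p ≤ S := Finset.single_le_sum (f := K) (fun _ _ => zero_le) (Finset.mem_range.2 (by omega))
  refine h1.trans ?_
  rw [← ENNReal.ofReal_pow (by positivity)]
  conv_lhs => rw [← ENNReal.ofReal_toReal hSt]
  apply ENNReal.ofReal_le_ofReal
  have := ENNReal.toReal_nonneg (a := S)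
  nlinarith
end

section
/- For every α with 0 < α < 1 there exist constants c₁, c₂ > 0 such that, setting h(y) = c₁ e^{−c₂|y|²} for y ∈ ℝ², one has: (i) for all q ∈ ℝ², (1 + |q|²)^{−α} ≤ ∫_{ℝ²} h(y) |q − y|^{−2α} dy; and (ii) sup_{q ∈ ℝ²} ∫_{ℝ²} h(y) |q − y|^{−2α} dy < ∞. -/
open MeasureTheory
open scoped ENNReal

local notation "E2" => EuclideanSpace ℝ (Fin 2)

lemma aux_ball (α : ℝ) (hα1 : α < 1) :
    ∫⁻ x : E2, (Metric.ball (0 : E2) 1).indicator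
      (fun x => ENNReal.ofReal (‖x‖ ^ (-(2 * α)))) x < ⊤ := by
  rw [lintegral_indicator measurableSet_ball]
  have h : IntegrableOn (fun x : E2 => ‖x‖ ^ (-(2 * α))) (Metric.ball 0 1) volume := by
    refine integrableOn_ball_of_norm_le_rpow (C := 1) (α := 2 * α) (by simp) ?_ ?_ ?_
    · simp; linarith
    · refine Filter.Eventually.of_forall fun x => ?_
      rw [Real.norm_of_nonneg (by positivity), one_mul]
    · exact (measurable_norm.pow_const _).aestronglyMeasurable
  exact Integrable.lintegral_lt_top h

lemma aux_gauss :
    ∫⁻ x : E2, ENNReal.ofReal (Real.exp (-1 * ‖x‖ ^ 2)) < ⊤ := by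
  have h := (GaussianFourier.integrable_cexp_neg_mul_sq_norm_add (V := E2) (b := 1)
    (by simp) 0 0).norm
  have h2 : Integrable (fun x : E2 => Real.exp (-1 * ‖x‖ ^ 2)) := by
    refine h.congr (Filter.Eventually.of_forall fun x => ?_)
    simp only [Complex.norm_exp]
    congr 1
    simp [← Complex.ofReal_pow]
  exact h2.lintegral_lt_top

/-- Gaussian majorant in the proof of Theorem 4.1: for every
`0 < α < 1` there are `c₁, c₂ > 0` such that, with `h(y) = c₁ e^{−c₂|y|²}` on `ℝ²`,
(i) `(1+|q|²)^{−α} ≤ ∫ h(y) |q−y|^{−2α} dy` for all `q ∈ ℝ²`, and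
(ii) `sup_q ∫ h(y) |q−y|^{−2α} dy < ∞`. -/
theorem gaussian_majorant_exists
    (α : ℝ) (hα0 : 0 < α) (hα1 : α < 1) :
    ∃ c₁ : ℝ, 0 < c₁ ∧ ∃ c₂ : ℝ, 0 < c₂ ∧
      ((∀ q : EuclideanSpace ℝ (Fin 2),
          ENNReal.ofReal ((1 + ‖q‖ ^ 2) ^ (-α)) ≤
            ∫⁻ y : EuclideanSpace ℝ (Fin 2),
              ENNReal.ofReal (c₁ * Real.exp (-c₂ * ‖y‖ ^ 2) * ‖q - y‖ ^ (-(2 * α)))) ∧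
        ∃ M : ℝ, ∀ q : EuclideanSpace ℝ (Fin 2),
          (∫⁻ y : EuclideanSpace ℝ (Fin 2),
              ENNReal.ofReal (c₁ * Real.exp (-c₂ * ‖y‖ ^ 2) * ‖q - y‖ ^ (-(2 * α)))) ≤
            ENNReal.ofReal M) := by
  set V : ℝ := (volume (Metric.ball (0 : E2) 1)).toReal with hV
  have hVtop : volume (Metric.ball (0 : E2) 1) ≠ ⊤ := measure_ball_lt_top.ne
  have hVpos : 0 < V := ENNReal.toReal_pos (Metric.measure_ball_pos _ _ one_pos).ne' hVtop
  have hc : 0 < 2 ^ α * Real.exp 1 / V := by positivity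
  refine ⟨2 ^ α * Real.exp 1 / V, hc, 1, one_pos, ?_, ?_⟩
  · intro q
    set b : ℝ := (1 + ‖q‖ ^ 2) ^ (-α) with hb
    calc ENNReal.ofReal b
        = ∫⁻ y in Metric.ball (0 : E2) 1, ENNReal.ofReal (b / V) := by
          rw [setLIntegral_const, ← ENNReal.ofReal_toReal hVtop, ← hV,
            ← ENNReal.ofReal_mul (by positivity), div_mul_cancel₀ _ hVpos.ne']
      _ ≤ ∫⁻ y in Metric.ball (0 : E2) 1, ENNReal.ofReal
            (2 ^ α * Real.exp 1 / V * Real.exp (-1 * ‖y‖ ^ 2) * ‖q - y‖ ^ (-(2 * α))) := by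
          have hne : ∀ᵐ y ∂(volume.restrict (Metric.ball (0 : E2) 1)), y ≠ q :=
            ae_restrict_of_ae (Measure.ae_ne volume q)
          refine lintegral_mono_ae ?_
          filter_upwards [hne, ae_restrict_mem measurableSet_ball] with y hy hy1
          apply ENNReal.ofReal_le_ofReal
          have hy1' : ‖y‖ < 1 := by simpa using hy1
          have hpos : 0 < ‖q - y‖ := norm_pos_iff.2 (sub_ne_zero.2 hy.symm)
          have h1 : ‖q - y‖ ^ 2 ≤ 2 * (1 + ‖q‖ ^ 2) := by
            have := norm_sub_le q y
            nlinarith [sq_nonneg (‖q‖ - 1), norm_nonneg q, norm_nonneg y]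
          have h2 : (2 * (1 + ‖q‖ ^ 2)) ^ (-α) ≤ ‖q - y‖ ^ (-(2 * α)) := by
            have e : ‖q - y‖ ^ (-(2 * α)) = (‖q - y‖ ^ 2) ^ (-α) := by
              rw [← Real.rpow_natCast, ← Real.rpow_mul hpos.le]
              congr 1; push_cast; ring
            rw [e]
            exact Real.rpow_le_rpow_of_nonpos (by positivity) h1 (by linarith)
          have h3 : Real.exp (-1) ≤ Real.exp (-1 * ‖y‖ ^ 2) := by
            apply Real.exp_le_exp.2
            nlinarith [norm_nonneg y]
          have h4 : b / V = 2 ^ α * Real.exp 1 / V * Real.exp (-1)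
              * (2 * (1 + ‖q‖ ^ 2)) ^ (-α) := by
            rw [Real.mul_rpow (by norm_num) (by positivity), ← hb,
              Real.rpow_neg (by norm_num), Real.exp_neg]
            have : (2 : ℝ) ^ α ≠ 0 := by positivity
            field_simp
          rw [h4]
          gcongr
      _ ≤ _ := setLIntegral_le_lintegral _ _
  · set c := 2 ^ α * Real.exp 1 / V
    refine ⟨(ENNReal.ofReal c * ((∫⁻ x : E2, (Metric.ball (0 : E2) 1).indicator
      (fun x => ENNReal.ofReal (‖x‖ ^ (-(2 * α)))) x) +
      ∫⁻ x : E2, ENNReal.ofReal (Real.exp (-1 * ‖x‖ ^ 2)))).toReal, fun q => ?_⟩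
    rw [ENNReal.ofReal_toReal (ENNReal.mul_ne_top ENNReal.ofReal_ne_top
      (ENNReal.add_ne_top.2 ⟨(aux_ball α hα1).ne, aux_gauss.ne⟩))]
    rw [← lintegral_sub_left_eq_self (fun x : E2 => (Metric.ball (0 : E2) 1).indicator
      (fun x => ENNReal.ofReal (‖x‖ ^ (-(2 * α)))) x) q,
      ← lintegral_add_right _ (by fun_prop),
      ← lintegral_const_mul' _ _ ENNReal.ofReal_ne_top]
    refine lintegral_mono fun y => ?_
    simp only
    rw [mul_assoc, ENNReal.ofReal_mul hc.le]
    gcongr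
    by_cases hy : q - y ∈ Metric.ball (0 : E2) 1
    · rw [Set.indicator_of_mem hy]
      refine le_trans (ENNReal.ofReal_le_ofReal ?_) le_self_add
      refine mul_le_of_le_one_left (by positivity) (Real.exp_le_one_iff.2 ?_)
      nlinarith [sq_nonneg ‖y‖]
    · refine le_trans (ENNReal.ofReal_le_ofReal ?_) le_add_self
      refine mul_le_of_le_one_right (by positivity) ?_
      refine Real.rpow_le_one_of_one_le_of_nonpos ?_ (by linarith)
      simpa using hy
end
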